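/- arXiv:math/0702352 — 3 statements merged into one kernel-verified Lean document; each statement's English description precedes it below -/
import Mathlib

section
/- Let n ∈ ℕ, let X and Y satisfy |X| = |Y| ≥ n² + n, and let I ∈ {0,1}⁴. Then each of the ordered graphs M^<_I(X,Y) and M^>_I(X,Y) has at least 2^{n-1} pairwise non-isomorphic (as ordered graphs) induced ordered subgraphs of order n. -/
open Finset

/-- `IndSub G H` : `G` is an induced ordered subgraph of `H`, i.e. there is an
order-preserving injection of the vertices preserving adjacency and non-adjacency. -/
def IndSub {m n : ℕ} (G : SimpleGraph (Fin m)) (H : SimpleGraph (Fin n)) : Prop :=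
  ∃ φ : Fin m ↪o Fin n, ∀ i j : Fin m, G.Adj i j ↔ H.Adj (φ i) (φ j)

/-- A hereditary property of ordered graphs: a family of ordered graphs (one set of
graphs on `[n]` for each `n`), closed under taking induced ordered subgraphs.  (Closure
under order-preserving isomorphisms is automatic in this encoding, since the only
order-preserving bijection of `Fin n` is the identity.) -/
structure HerProp where
  mem : ∀ n : ℕ, Set (SimpleGraph (Fin n))
  hered : ∀ {m n : ℕ} (G : SimpleGraph (Fin m)) (H : SimpleGraph (Fin n)),
    IndSub G H → H ∈ mem n → G ∈ mem m

/-- The speed of a property: `n ↦ |P_n|`. -/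
noncomputable def speed (P : HerProp) (n : ℕ) : ℕ := (P.mem n).ncard

/-- Generalized Fibonacci numbers `F_{n,k}` of order `k`:
`F_{0,k} = 1`, `F_{n,k} = F_{n-1,k} + ⋯ + F_{n-k,k}` (terms with negative index are 0). -/
def genFib (k : ℕ) : ℕ → ℕ
  | 0 => 1
  | n + 1 => ∑ i ∈ Finset.range k, if i ≤ n then genFib k (n - i) else 0
decreasing_by omega

/-- `lHom G ℓ x y` : vertices `x` and `y` are `ℓ`-homogeneous in `G`
(`x ∼_ℓ y`), i.e. they have the same neighbourhoods outside `N_ℓ(x) ∪ N_ℓ(y)`. -/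
def lHom {N : ℕ} (G : SimpleGraph (Fin N)) (ℓ : ℕ) (x y : Fin N) : Prop :=
  ∀ v : Fin N, ℓ ≤ ((v : ℤ) - (x : ℤ)).natAbs → ℓ ≤ ((v : ℤ) - (y : ℤ)).natAbs →
    (G.Adj x v ↔ G.Adj y v)

/-- `G` contains a `k`-structure of Type 1. -/
def HasType1 {N : ℕ} (G : SimpleGraph (Fin N)) (k : ℕ) : Prop :=
  ∃ (y : Fin N) (x : Fin (2 * k) → Fin N), StrictMono x ∧
    ((∀ i, y < x i) ∨ (∀ i, x i < y)) ∧
    ∀ i j : Fin (2 * k), (j : ℕ) = (i : ℕ) + 1 → (G.Adj y (x i) ↔ ¬ G.Adj y (x j))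

/-- `G` contains a `k`-structure of Type 2 (2(a) or 2(b)). -/
def HasType2 {N : ℕ} (G : SimpleGraph (Fin N)) (k : ℕ) : Prop :=
  ∃ x y : Fin (2 * k) → Fin N, StrictMono x ∧ (StrictMono y ∨ StrictAnti y) ∧
    (∀ i j, x i < y j) ∧
    ∀ i j : Fin (2 * k), (j : ℕ) = (i : ℕ) + 1 → (G.Adj (x i) (y i) ↔ ¬ G.Adj (x j) (y j))

/-- `G` contains a `(k,ℓ)`-structure of Type 3. -/
def HasType3 {N : ℕ} (G : SimpleGraph (Fin N)) (k ℓ : ℕ) : Prop :=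
  ∃ (x y : Fin (2 * k) → Fin N) (z : Fin (2 * k) → Fin (ℓ - 1) → Fin N),
    (∀ i t, x i < z i t) ∧ (∀ i, StrictMono (z i)) ∧ (∀ i t, z i t < y i) ∧
    (∀ i, x i < y i) ∧
    (∀ i j : Fin (2 * k), (j : ℕ) = (i : ℕ) + 1 → y i < x j) ∧
    ∀ i j : Fin (2 * k), (j : ℕ) = (i : ℕ) + 1 → (G.Adj (x i) (y i) ↔ ¬ G.Adj (x j) (y j))

/-- `S_n(G)` : the number of pairwise non-isomorphic (as ordered graphs) induced ordered
subgraphs of `G` of order `n`. -/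
noncomputable def numSub {N : ℕ} (G : SimpleGraph (Fin N)) (n : ℕ) : ℕ :=
  {H : SimpleGraph (Fin n) | IndSub H G}.ncard
/-- The ordered graph `M^<_I(X,Y)` with `|X| = |Y| = m` (vertices `0,…,m-1` playing the
role of `x_1 < … < x_m` and vertices `m,…,2m-1` the role of `y_1 < … < y_m`). -/
def Mlt (m : ℕ) (I1 I2 I3 I4 : Bool) : SimpleGraph (Fin (2 * m)) :=
  SimpleGraph.fromRel (fun u v =>
    ((u : ℕ) < m ∧ (v : ℕ) < m ∧ I1 = true) ∨
    (m ≤ (u : ℕ) ∧ m ≤ (v : ℕ) ∧ I4 = true) ∨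
    ((u : ℕ) < m ∧ m ≤ (v : ℕ) ∧
      (((u : ℕ) < (v : ℕ) - m ∧ I2 = true) ∨
       ((v : ℕ) - m < (u : ℕ) ∧ I3 = true) ∨
       ((u : ℕ) = (v : ℕ) - m ∧ Even (u : ℕ)))))

/-- The ordered graph `M^>_I(X,Y)`: as `M^<_I(X,Y)` but with the `y`-indices reversed,
i.e. vertex `m + p` plays the role of `y_{m-p}` (so that `y_1 > y_2 > … > y_m`). -/
def Mgt (m : ℕ) (I1 I2 I3 I4 : Bool) : SimpleGraph (Fin (2 * m)) :=
  SimpleGraph.fromRel (fun u v =>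
    ((u : ℕ) < m ∧ (v : ℕ) < m ∧ I1 = true) ∨
    (m ≤ (u : ℕ) ∧ m ≤ (v : ℕ) ∧ I4 = true) ∨
    ((u : ℕ) < m ∧ m ≤ (v : ℕ) ∧
      (((u : ℕ) < 2 * m - 1 - (v : ℕ) ∧ I2 = true) ∨
       (2 * m - 1 - (v : ℕ) < (u : ℕ) ∧ I3 = true) ∨
       ((u : ℕ) = 2 * m - 1 - (v : ℕ) ∧ Even (u : ℕ)))))

/-- `B` is a set of consecutive vertices which is pairwise 1-homogeneous. -/
def IsHomInterval {N : ℕ} (G : SimpleGraph (Fin N)) (B : Set (Fin N)) : Prop :=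
  (∀ x y z : Fin N, x ∈ B → z ∈ B → x ≤ y → y ≤ z → y ∈ B) ∧
  (∀ x ∈ B, ∀ y ∈ B, lHom G 1 x y)

/-- A homogeneous block of `G`: a maximal 1-homogeneous set of consecutive vertices. -/
def IsHomBlock {N : ℕ} (G : SimpleGraph (Fin N)) (B : Set (Fin N)) : Prop :=
  B.Nonempty ∧ IsHomInterval G B ∧ ∀ B' : Set (Fin N), B ⊆ B' → IsHomInterval G B' → B = B'

/-- `G` has at most `k` homogeneous blocks. -/
def HomBlocksLE {N : ℕ} (G : SimpleGraph (Fin N)) (k : ℕ) : Prop :=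
  {B : Set (Fin N) | IsHomBlock G B}.ncard ≤ k

/-- `TailBound G k M` : the homogeneous block sequence `t_1 ≥ t_2 ≥ …` of `G` satisfies
`Σ_{i=k+2}^∞ t_i ≤ M`, i.e. some (equivalently, the largest) `k+1` homogeneous blocks
cover all but at most `M` vertices. -/
def TailBound {N : ℕ} (G : SimpleGraph (Fin N)) (k M : ℕ) : Prop :=
  ∃ S : Finset (Set (Fin N)), S.card ≤ k + 1 ∧ (∀ B ∈ S, IsHomBlock G B) ∧
    {v : Fin N | ∀ B ∈ S, v ∉ B}.ncard ≤ M

/-- An ordered graph is irreducible if no pair of vertices `u < v` separates its edges. -/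
def IrredGraph {N : ℕ} (G : SimpleGraph (Fin N)) : Prop :=
  ¬ ∃ u v : Fin N, u < v ∧
      ∀ i j : Fin N, i < j → G.Adj i j → ((j : ℕ) ≤ (u : ℕ) ∨ (v : ℕ) ≤ (i : ℕ))

/-- `G` is `ℓ`-empty: it has no edges of length at least `ℓ`. -/
def lEmpty {N : ℕ} (G : SimpleGraph (Fin N)) (ℓ : ℕ) : Prop :=
  ∀ u v : Fin N, G.Adj u v → ((u : ℤ) - (v : ℤ)).natAbs < ℓ

/-- `IsFamSum G sz Gs` : `G = G_1 + … + G_s`, the consecutive sum of the ordered graphs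
`Gs 0, …, Gs (s-1)` (of orders `sz 0, …, sz (s-1)`), with no edges between summands. -/
def IsFamSum {N s : ℕ} (G : SimpleGraph (Fin N)) (sz : Fin s → ℕ)
    (Gs : ∀ i, SimpleGraph (Fin (sz i))) : Prop :=
  N = ∑ i, sz i ∧
  ∀ u v : Fin N, G.Adj u v ↔ ∃ (i : Fin s) (x y : Fin (sz i)),
    (Gs i).Adj x y ∧
    (u : ℕ) = (∑ j ∈ Finset.univ.filter (fun j => j < i), sz j) + (x : ℕ) ∧
    (v : ℕ) = (∑ j ∈ Finset.univ.filter (fun j => j < i), sz j) + (y : ℕ)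

/-- `(Gs 0, …, Gs (s-1))` is the irreducible block decomposition of `G`:
`G = G_1 + ⋯ + G_s` with every block nonempty and irreducible.  (Such a
decomposition is unique.) -/
def IsIrredDecomp {N s : ℕ} (G : SimpleGraph (Fin N)) (sz : Fin s → ℕ)
    (Gs : ∀ i, SimpleGraph (Fin (sz i))) : Prop :=
  IsFamSum G sz Gs ∧ (∀ i, 1 ≤ sz i) ∧ ∀ i, IrredGraph (Gs i)

/-- `J_1^{(n)} = K_n`. -/
def Jgraph1 (n : ℕ) : SimpleGraph (Fin n) := ⊤

/-- `J_2^{(n)}` : single edge `{1,n}`. -/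
def Jgraph2 (n : ℕ) : SimpleGraph (Fin n) :=
  SimpleGraph.fromRel (fun u v => (u : ℕ) = 0 ∧ (v : ℕ) = n - 1)

/-- `J_3^{(n)}` : star at the first vertex. -/
def Jgraph3 (n : ℕ) : SimpleGraph (Fin n) :=
  SimpleGraph.fromRel (fun u _ => (u : ℕ) = 0)

/-- `J_4^{(n)}` : star at the last vertex. -/
def Jgraph4 (n : ℕ) : SimpleGraph (Fin n) :=
  SimpleGraph.fromRel (fun _ v => (v : ℕ) = n - 1)

/-- `L^{(n)}` : the monotone path. -/
def Lgraph (n : ℕ) : SimpleGraph (Fin n) :=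
  SimpleGraph.fromRel (fun u v => (v : ℕ) = (u : ℕ) + 1)

/-- `Q_1` : edge set `{13, 24}` on `[4]`. -/
def Qgraph1 : SimpleGraph (Fin 4) :=
  SimpleGraph.fromRel (fun u v => ((u : ℕ) = 0 ∧ (v : ℕ) = 2) ∨ ((u : ℕ) = 1 ∧ (v : ℕ) = 3))

/-- `Q_2` : edge set `{14, 23}` on `[4]`. -/
def Qgraph2 : SimpleGraph (Fin 4) :=
  SimpleGraph.fromRel (fun u v => ((u : ℕ) = 0 ∧ (v : ℕ) = 3) ∨ ((u : ℕ) = 1 ∧ (v : ℕ) = 2))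

/-- `G` is order-isomorphic to a member of the family `𝒥`. -/
def InJ {n : ℕ} (G : SimpleGraph (Fin n)) : Prop :=
  G = Jgraph1 n ∨ G = Jgraph2 n ∨ G = Jgraph3 n ∨ G = Jgraph4 n ∨ G = Lgraph n ∨
  (n = 4 ∧ IndSub G Qgraph1) ∨ (n = 4 ∧ IndSub G Qgraph2)

/-- `G` is order-isomorphic to a member of `𝒥_ℓ`. -/
def InJle (ℓ : ℕ) {n : ℕ} (G : SimpleGraph (Fin n)) : Prop :=
  (n ≤ ℓ ∧ (G = Jgraph1 n ∨ G = Jgraph2 n ∨ G = Jgraph3 n ∨ G = Jgraph4 n ∨ G = Lgraph n)) ∨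
  (4 ≤ ℓ ∧ n = 4 ∧ (IndSub G Qgraph1 ∨ IndSub G Qgraph2))

/-- `A` is a sum `B_1 + ⋯ + B_t` of members of `𝒥_ℓ` which are pairwise comparable in
the induced ordered subgraph order. -/
def InJA (ℓ : ℕ) {n : ℕ} (A : SimpleGraph (Fin n)) : Prop :=
  ∃ (t : ℕ) (sz : Fin t → ℕ) (Bs : ∀ j, SimpleGraph (Fin (sz j))),
    IsFamSum A sz Bs ∧ (∀ j, InJle ℓ (Bs j)) ∧
    ∀ j j', IndSub (Bs j) (Bs j') ∨ IndSub (Bs j') (Bs j)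

/-- `G ∈ 𝒥(k,ℓ)`. -/
def InJkl (k ℓ : ℕ) {n : ℕ} (G : SimpleGraph (Fin n)) : Prop :=
  ∃ (s : ℕ) (sz : Fin s → ℕ) (As : ∀ i, SimpleGraph (Fin (sz i))),
    s ≤ k ∧ IsFamSum G sz As ∧ ∀ i, InJA ℓ (As i)


/-- Adjacency phrased on natural numbers. -/
def aN {n : ℕ} (H : SimpleGraph (Fin n)) (u v : ℕ) : Prop :=
  ∃ (hu : u < n) (hv : v < n), H.Adj ⟨u, hu⟩ ⟨v, hv⟩

/-- Directed comparison: increasing or decreasing. -/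
def dlt (d : Bool) (u v : ℕ) : Prop := (d = true ∧ u < v) ∨ (d = false ∧ v < u)

/-- `pos` places the first `#S` vertices on the positions in `S` and the others off `S`. -/
structure PosOK (n : ℕ) (d : Bool) (S : Finset ℕ) (pos : ℕ → ℕ) : Prop where
  lt : ∀ v, v < n → pos v < n
  memX : ∀ v, v < #S → pos v ∈ S
  memY : ∀ v, #S ≤ v → v < n → pos v ∉ S
  monoX : ∀ u v, u < #S → v < #S → dlt d u v → pos u < pos v
  monoY : ∀ u v, #S ≤ u → u < v → v < n → pos u < pos v
  surj : ∀ p, p < n → ∃ v, v < n ∧ pos v = p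

lemma enum_set (S : Finset ℕ) : ∃ e : ℕ → ℕ, (∀ v, v < #S → e v ∈ S) ∧
    (∀ u v, u < v → v < #S → e u < e v) ∧ (∀ p ∈ S, ∃ v, v < #S ∧ e v = p) := by
  have hf : (Set.ofPred (fun x => x ∈ S)).Finite := S.finite_toSet
  have hc : hf.toFinset = S := by ext; simp
  refine ⟨Nat.nth (· ∈ S), ?_, ?_, ?_⟩
  · intro v hv
    exact Nat.nth_mem_of_lt_card (p := (· ∈ S)) hf (by rw [hc]; exact hv)
  · intro u v huv hv
    exact Nat.nth_lt_nth_of_lt_card (p := (· ∈ S)) hf huv (by rw [hc]; exact hv)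
  · intro p hp
    obtain ⟨v, hv, h⟩ := Nat.exists_lt_card_finite_nth_eq (p := (· ∈ S)) hf hp
    exact ⟨v, by rw [hc] at hv; exact hv, h⟩

lemma pos_exists (n : ℕ) (d : Bool) (S : Finset ℕ) (hS : S ⊆ range n) :
    ∃ pos, PosOK n d S pos := by
  obtain ⟨e, e1, e2, e3⟩ := enum_set S
  obtain ⟨f, f1, f2, f3⟩ := enum_set (range n \ S)
  have hc : #(range n \ S) = n - #S := by rw [card_sdiff_of_subset hS, card_range]
  have hle : #S ≤ n := by simpa using card_le_card hS
  rw [hc] at f1 f2 f3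
  have hSn : ∀ x ∈ S, x < n := fun x hx => mem_range.1 (hS hx)
  have f1' : ∀ v, v < n - #S → f v < n ∧ f v ∉ S := fun v hv => by
    have := f1 v hv; simpa using this
  refine ⟨fun v => if v < #S then (if d = true then e v else e (#S - 1 - v)) else f (v - #S),
    ?_, ?_, ?_, ?_, ?_, ?_⟩
  · intro v hv
    split_ifs with h1 h2
    · exact hSn _ (e1 _ h1)
    · exact hSn _ (e1 _ (by omega))
    · exact (f1' _ (by omega)).1
  · intro v hv
    split_ifs with h2
    · exact e1 _ hv
    · exact e1 _ (by omega)
  · intro v hv hn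
    rw [if_neg (by omega)]
    exact (f1' _ (by omega)).2
  · intro u v hu hv h
    rw [if_pos hu, if_pos hv]
    rcases h with ⟨h, h'⟩ | ⟨h, h'⟩
    · simp only [h, if_true]; exact e2 _ _ h' hv
    · simp only [h]; exact e2 _ _ (by omega) (by omega)
  · intro u v hu h hv
    rw [if_neg (by omega), if_neg (by omega)]
    exact f2 _ _ (by omega) (by omega)
  · intro p hp
    by_cases hpS : p ∈ S
    · obtain ⟨v, hv, rfl⟩ := e3 p hpS
      cases d
      · refine ⟨#S - 1 - v, by omega, ?_⟩
        rw [if_pos (by omega), if_neg (by simp)]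
        congr 1; omega
      · exact ⟨v, by omega, by simp [hv]⟩
    · obtain ⟨v, hv, rfl⟩ := f3 p (by simp [hp, hpS])
      refine ⟨v + #S, by omega, by simp⟩

lemma PosOK.inj {n d S pos} (h : PosOK n d S pos) (hS : #S ≤ n) :
    Set.InjOn pos (range n) := by
  intro u hu v hv huv
  simp only [coe_range, Set.mem_Iio] at hu hv
  by_contra hne
  have a1 := h.memX u
  have a2 := h.memX v
  have b1 := h.memY u
  have b2 := h.memY v
  have c1 := h.monoX u v
  have c2 := h.monoX v u
  have d1 := h.monoY u v
  have d2 := h.monoY v u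
  unfold dlt at c1 c2
  cases d <;> grind

lemma PosOK.count {n d S pos} (h : PosOK n d S pos) (hS : #S ≤ n) (c : ℕ) (hc : c ≤ n) :
    #{v ∈ range n | pos v < c} = c := by
  have : image pos {v ∈ range n | pos v < c} = range c := by
    ext p
    simp only [mem_image, mem_filter, mem_range]
    constructor
    · rintro ⟨v, ⟨_, h2⟩, rfl⟩; exact h2
    · intro hp
      obtain ⟨v, hv, rfl⟩ := h.surj p (by omega)
      exact ⟨v, ⟨hv, hp⟩, rfl⟩
  rw [← card_image_of_injOn ((h.inj hS).mono (by intro x hx; simp at hx ⊢; exact hx.1)), this, card_range]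

lemma PosOK.lt_iff {n d S pos} (h : PosOK n d S pos) (u v : ℕ) (hu : u < #S) (hv : v < #S) :
    pos u < pos v ↔ dlt d u v := by
  refine ⟨fun hlt => ?_, h.monoX u v hu hv⟩
  by_contra hne
  have := h.monoX v u hv hu
  unfold dlt at *
  rcases Nat.lt_trichotomy u v with h1 | h1 | h1
  · cases d <;> grind
  · subst h1; omega
  · cases d <;> grind

lemma PosOK.set_eq {n d S S' pos pos'} (h : PosOK n d S pos) (h' : PosOK n d S' pos')
    (hS : S ⊆ range n) (hS' : S' ⊆ range n) (hb : #S = #S')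
    (hB : ∀ u v, u < #S → #S ≤ v → v < n → (pos u < pos v ↔ pos' u < pos' v)) : S = S' := by
  have hle : #S ≤ n := by simpa using card_le_card hS
  have key : ∀ i, i < #S → pos i = pos' i := by
    intro i hi
    rw [← h.count hle (pos i) (h.lt i (by omega)).le,
      ← h'.count (hb ▸ hle) (pos' i) (h'.lt i (by omega)).le]
    congr 1
    apply filter_congr
    intro v hv
    rw [mem_range] at hv
    by_cases hvb : v < #S
    · rw [h.lt_iff v i hvb hi, h'.lt_iff v i (hb ▸ hvb) (hb ▸ hi)]
    · have h1 := hB i v hi (by omega) hv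
      have h2 : pos i ≠ pos v := fun e => by
        have := h.inj hle (by simp; omega) (by simp; omega) e
        omega
      have h3 : pos' i ≠ pos' v := fun e => by
        have := h'.inj (hb ▸ hle) (by simp; omega) (by simp; omega) e
        omega
      omega
  have hsub : ∀ x ∈ S, x ∈ S' := by
    intro x hx
    obtain ⟨v, hv, rfl⟩ := h.surj x (mem_range.1 (hS hx))
    have : v < #S := by
      by_contra hc
      exact h.memY v (by omega) hv hx
    rw [key v this]
    exact h'.memX v (hb ▸ this)
  exact eq_of_subset_of_card_le hsub hb.ge

lemma card_family (n a : ℕ) (ha : a < n) : #{S ∈ (range n).powerset | a ∈ S} = 2 ^ (n - 1) := by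
  have : {S ∈ (range n).powerset | a ∈ S} = ((range n).erase a).powerset.image (insert a) := by
    ext S
    simp only [mem_filter, mem_powerset, mem_image]
    constructor
    · rintro ⟨h1, h2⟩
      exact ⟨S.erase a, erase_subset_erase a h1, insert_erase h2⟩
    · rintro ⟨T, hT, rfl⟩
      refine ⟨?_, by simp⟩
      intro x hx
      rcases mem_insert.1 hx with rfl | hx
      · simpa using ha
      · exact mem_of_mem_erase (hT hx)
  rw [this, card_image_of_injOn, card_powerset, card_erase_of_mem (by simpa using ha), card_range]
  intro S hS T hT hST
  simp only [coe_powerset, Set.mem_preimage, Set.mem_powerset_iff, coe_subset] at hS hT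
  have h1 : a ∉ S := fun h => by simpa using hS h
  have h2 : a ∉ T := fun h => by simpa using hT h
  rw [← erase_insert h1, ← erase_insert h2]
  exact congrArg (fun s => erase s a) hST

lemma core {N : ℕ} (G : SimpleGraph (Fin N)) (n a : ℕ) (ha : a < n) (I1 : Bool) (d : Bool)
    (B : SimpleGraph (Fin n) → ℕ → ℕ → ℕ → Prop)
    (h : ∀ S, S ⊆ range n → a ∈ S → ∃ H pos, IndSub H G ∧ PosOK n d S pos ∧
      (∀ u v, u < v → v < #S → (aN H u v ↔ I1 = true)) ∧
      (#S < n → ∃ u, u < #S ∧ (aN H u #S ↔ ¬ I1 = true)) ∧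
      (∀ u v, u < #S → #S ≤ v → v < n → (pos u < pos v ↔ B H #S u v))) :
    2 ^ (n - 1) ≤ numSub G n := by
  classical
  choose! F P h1 h2 h3 h4 h5 using h
  rw [← card_family n a ha, numSub, ← Set.ncard_coe_finset]
  refine Set.ncard_le_ncard_of_injOn F ?_ ?_ (Set.toFinite _)
  · intro S hS
    simp only [coe_filter, mem_powerset, Set.mem_ofPred_eq] at hS
    exact h1 S hS.1 hS.2
  · have key : ∀ S S', S ⊆ range n → a ∈ S → S' ⊆ range n → a ∈ S' → F S = F S' →
        ¬ #S < #S' := by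
      intro S S' hS haS hS' haS' he hlt
      have hle : #S' ≤ n := by simpa using card_le_card hS'
      obtain ⟨u, hu, hu'⟩ := h4 S hS haS (by omega)
      have := h3 S' hS' haS' u #S hu hlt
      rw [← he, hu'] at this
      tauto
    intro S hS S' hS' he
    simp only [coe_filter, mem_powerset, Set.mem_ofPred_eq] at hS hS'
    have hb : #S = #S' := by
      have k1 := key S S' hS.1 hS.2 hS'.1 hS'.2 he
      have k2 := key S' S hS'.1 hS'.2 hS.1 hS.2 he.symm
      omega
    refine (h2 S hS.1 hS.2).set_eq (h2 S' hS'.1 hS'.2) hS.1 hS'.1 hb ?_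
    intro u v hu hv hn
    rw [h5 S hS.1 hS.2 u v hu hv hn, h5 S' hS'.1 hS'.2 u v (hb ▸ hu) (hb ▸ hv) hn, he, hb]

/-- Abstract embedding property shared by `Mlt` and `Mgt`. -/
def Good (m : ℕ) (G : SimpleGraph (Fin (2 * m))) (d I1 J2 J3 : Bool) (g : ℕ) : Prop :=
  ∀ (n b : ℕ) (idx : ℕ → ℕ), b ≤ n → (∀ v, v < n → idx v < m) →
    (∀ u v, u < b → v < b → dlt d u v → idx u < idx v) →
    (∀ u v, b ≤ u → u < v → v < n → idx u < idx v) →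
    ∃ H : SimpleGraph (Fin n), IndSub H G ∧
      (∀ u v, u < v → v < b → (aN H u v ↔ I1 = true)) ∧
      (∀ u v, u < b → b ≤ v → v < n → (aN H u v ↔
        (idx u < idx v ∧ J2 = true) ∨ (idx v < idx u ∧ J3 = true) ∨
        (idx u = idx v ∧ idx u % 2 = g)))

lemma ind_of {n N : ℕ} (G : SimpleGraph (Fin N)) (f : ℕ → ℕ) (hf : ∀ v, v < n → f v < N)
    (hm : ∀ u v, u < v → v < n → f u < f v) :
    ∃ H : SimpleGraph (Fin n), IndSub H G ∧ ∀ u v, v < n → u < n →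
      (aN H u v ↔ aN G (f u) (f v)) := by
  let φ : Fin n ↪o Fin N := OrderEmbedding.ofStrictMono (fun v => ⟨f v, hf v v.2⟩)
    (fun u v huv => by simpa using hm u v huv v.2)
  refine ⟨G.comap φ, ⟨φ, fun i j => Iff.rfl⟩, ?_⟩
  intro u v hv hu
  constructor
  · rintro ⟨_, _, h⟩
    exact ⟨hf u hu, hf v hv, h⟩
  · rintro ⟨_, _, h⟩
    exact ⟨hu, hv, h⟩

lemma good_lt (m : ℕ) (I1 I2 I3 I4 : Bool) : Good m (Mlt m I1 I2 I3 I4) true I1 I2 I3 0 := by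
  intro n b idx hb hlt hX hY
  have hX' : ∀ u v, u < v → v < b → idx u < idx v := fun u v huv hv =>
    hX u v (by omega) hv (Or.inl ⟨rfl, huv⟩)
  obtain ⟨H, hH, hA⟩ := ind_of (n := n) (Mlt m I1 I2 I3 I4)
    (fun v => if v < b then idx v else m + idx v)
    (fun v hv => by have := hlt v hv; split_ifs <;> omega)
    (fun u v huv hv => by
      have h1 := hlt v hv
      have h2 := hlt u (by omega)
      have h3 := hX' u v huv
      have h4 := hY u v
      split_ifs <;> omega)
  refine ⟨H, hH, ?_, ?_⟩
  · intro u v huv hv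
    rw [hA u v (by omega) (by omega), if_pos (by omega), if_pos hv]
    have h1 := hlt v (by omega)
    have h2 := hlt u (by omega)
    have h3 := hX' u v huv hv
    simp only [aN, Mlt, SimpleGraph.fromRel_adj, ne_eq, Fin.mk.injEq]
    grind
  · intro u v hu hv hn
    rw [hA u v (by omega) (by omega), if_pos (by omega), if_neg (by omega)]
    have h1 := hlt v (by omega)
    have h2 := hlt u (by omega)
    have e : m + idx v - m = idx v := by omega
    have q1 : ¬ (m + idx v < m) := by omega
    have q2 : ¬ (m ≤ idx u) := by omega
    have q3 : ¬ (idx u = m + idx v) := by omega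
    have q4 : idx u < 2 * m := by omega
    have q5 : m + idx v < 2 * m := by omega
    have q6 : m ≤ m + idx v := by omega
    simp only [aN, Mlt, SimpleGraph.fromRel_adj, ne_eq, Fin.mk.injEq, e, q1, q2, q3, q4, q5, q6, h2,
      Nat.even_iff, exists_prop, true_and, false_and, false_or, or_false, and_false,
      not_false_eq_true]

lemma good_gt (m : ℕ) (I1 I2 I3 I4 : Bool) :
    Good m (Mgt m I1 I2 I3 I4) false I1 I3 I2 ((m - 1) % 2) := by
  intro n b idx hb hlt hX hY
  have hX' : ∀ u v, u < v → v < b → idx v < idx u := fun u v huv hv =>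
    hX v u (by omega) (by omega) (Or.inr ⟨rfl, huv⟩)
  obtain ⟨H, hH, hA⟩ := ind_of (n := n) (Mgt m I1 I2 I3 I4)
    (fun v => if v < b then m - 1 - idx v else m + idx v)
    (fun v hv => by have := hlt v hv; split_ifs <;> omega)
    (fun u v huv hv => by
      have h1 := hlt v hv
      have h2 := hlt u (by omega)
      have h3 := hX' u v huv
      have h4 := hY u v
      split_ifs <;> omega)
  refine ⟨H, hH, ?_, ?_⟩
  · intro u v huv hv
    rw [hA u v (by omega) (by omega), if_pos (by omega), if_pos hv]
    have h1 := hlt v (by omega)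
    have h2 := hlt u (by omega)
    have h3 := hX' u v huv hv
    simp only [aN, Mgt, SimpleGraph.fromRel_adj, ne_eq, Fin.mk.injEq]
    grind
  · intro u v hu hv hn
    rw [hA u v (by omega) (by omega), if_pos (by omega), if_neg (by omega)]
    have h1 := hlt v (by omega)
    have h2 := hlt u (by omega)
    have e1 : (m - 1 - idx u < 2 * m - 1 - (m + idx v)) ↔ idx v < idx u := by omega
    have e2 : (2 * m - 1 - (m + idx v) < m - 1 - idx u) ↔ idx u < idx v := by omega
    have e3 : (m - 1 - idx u = 2 * m - 1 - (m + idx v)) ↔ idx u = idx v := by omega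
    have e4 : (m - 1 - idx u) % 2 = 0 ↔ idx u % 2 = (m - 1) % 2 := by omega
    have q1 : ¬ (m + idx v < m) := by omega
    have q2 : ¬ (m ≤ m - 1 - idx u) := by omega
    have q3 : ¬ (m - 1 - idx u = m + idx v) := by omega
    have q4 : m - 1 - idx u < 2 * m := by omega
    have q5 : m + idx v < 2 * m := by omega
    have q6 : m ≤ m + idx v := by omega
    have q7 : m - 1 - idx u < m := by omega
    simp only [aN, Mgt, SimpleGraph.fromRel_adj, ne_eq, Fin.mk.injEq, e1, e2, e3, e4, q1, q2, q3, q4,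
      q5, q6, q7, Nat.even_iff, exists_prop, true_and, false_and, false_or, or_false, and_false,
      not_false_eq_true]
    exact or_left_comm

/-- Case `J2 ≠ J3`: half graphs. -/
lemma half_case {m : ℕ} {G : SimpleGraph (Fin (2 * m))} {d I1 J2 J3 : Bool} {g : ℕ}
    (hG : Good m G d I1 J2 J3 g) (n : ℕ) (hn : 1 ≤ n) (hm : 2 * n ≤ m) (hJ : J2 ≠ J3) :
    2 ^ (n - 1) ≤ numSub G n := by
  have main : ∀ S, S ⊆ range n → ∃ (H : SimpleGraph (Fin n)) (pos : ℕ → ℕ), IndSub H G ∧ PosOK n d S pos ∧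
      (∀ u v, u < v → v < #S → (aN H u v ↔ I1 = true)) ∧
      (∀ u v, u < #S → #S ≤ v → v < n → (aN H u v ↔
        (pos u < pos v ∧ J2 = true) ∨ (pos v < pos u ∧ J3 = true))) ∧
      (∀ u v, u < #S → #S ≤ v → v < n → (pos u < pos v ↔ (aN H u v ↔ J2 = true))) := by
    intro S hS
    obtain ⟨pos, hp⟩ := pos_exists n d S hS
    have hle : #S ≤ n := by simpa using card_le_card hS
    obtain ⟨H, h1, h2, h3⟩ := hG n #S pos hle (fun v hv => by have := hp.lt v hv; omega)
      hp.monoX hp.monoY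
    have hne : ∀ u v, u < #S → #S ≤ v → v < n → pos u ≠ pos v := by
      intro u v hu hv hvn e
      have := hp.inj hle (by simp; omega) (by simp; omega) e
      omega
    have h4 : ∀ u v, u < #S → #S ≤ v → v < n → (aN H u v ↔
        (pos u < pos v ∧ J2 = true) ∨ (pos v < pos u ∧ J3 = true)) := by
      intro u v hu hv hvn
      rw [h3 u v hu hv hvn]
      have := hne u v hu hv hvn
      tauto
    refine ⟨H, pos, h1, hp, h2, h4, ?_⟩
    intro u v hu hv hvn
    rw [h4 u v hu hv hvn]
    have := hne u v hu hv hvn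
    cases J2 <;> cases J3 <;> simp at hJ ⊢ <;> omega
  have at_pos : ∀ S pos, PosOK n d S pos → ∀ p, p < n → p ∈ S → ∃ u, u < #S ∧ pos u = p := by
    intro S pos hp p hpn hpS
    obtain ⟨u, hu, rfl⟩ := hp.surj p hpn
    refine ⟨u, ?_, rfl⟩
    by_contra hc
    exact hp.memY u (by omega) hu hpS
  by_cases hI : I1 = J3
  · refine core G n 0 (by omega) I1 d (fun H _ u v => (aN H u v ↔ J2 = true)) ?_
    intro S hS h0
    obtain ⟨H, pos, h1, hp, h2, h4, h5⟩ := main S hS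
    refine ⟨H, pos, h1, hp, h2, ?_, h5⟩
    intro hlt
    obtain ⟨u, hu, hu0⟩ := at_pos S pos hp 0 (by omega) h0
    refine ⟨u, hu, ?_⟩
    have hv : pos #S ≠ 0 := fun e => hp.memY #S le_rfl hlt (e ▸ h0)
    rw [h4 u #S hu le_rfl hlt, hu0, hI]
    cases J2 <;> cases J3 <;> simp at hJ ⊢ <;> omega
  · refine core G n (n - 1) (by omega) I1 d (fun H _ u v => (aN H u v ↔ J2 = true)) ?_
    intro S hS h0
    obtain ⟨H, pos, h1, hp, h2, h4, h5⟩ := main S hS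
    refine ⟨H, pos, h1, hp, h2, ?_, h5⟩
    intro hlt
    obtain ⟨u, hu, hu0⟩ := at_pos S pos hp (n - 1) (by omega) h0
    refine ⟨u, hu, ?_⟩
    have hv : pos #S ≠ n - 1 := fun e => hp.memY #S le_rfl hlt (e ▸ h0)
    have hv' := hp.lt #S hlt
    rw [h4 u #S hu le_rfl hlt, hu0]
    cases I1 <;> cases J2 <;> cases J3 <;> simp at hI hJ ⊢ <;> omega

/-- Case `J2 = J3`: matchings. -/
lemma match_case {m : ℕ} {G : SimpleGraph (Fin (2 * m))} {d I1 J : Bool} {g : ℕ} (hg : g < 2)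
    (hG : Good m G d I1 J J g) (n : ℕ) (hn : 1 ≤ n) (hm : 2 * n ≤ m) :
    2 ^ (n - 1) ≤ numSub G n := by
  classical
  have main : ∀ S, S ⊆ range n → ∃ (H : SimpleGraph (Fin n)) (pos : ℕ → ℕ), IndSub H G ∧ PosOK n d S pos ∧
      (∀ u v, u < v → v < #S → (aN H u v ↔ I1 = true)) ∧
      (∀ u v, u < #S → #S ≤ v → v < n → (pos v = pos u + 1 ↔ (aN H u v ↔ ¬ J = true))) ∧
      (∀ u v, u < #S → #S ≤ v → v < n → (pos u < pos v ↔
        ∃ u' v', u' < #S ∧ #S ≤ v' ∧ v' ≤ v ∧ ¬ dlt d u' u ∧ (aN H u' v' ↔ ¬ J = true))) := by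
    intro S hS
    obtain ⟨pos, hp⟩ := pos_exists n d S hS
    have hle : #S ≤ n := by simpa using card_le_card hS
    -- the parity giving a cross pair that differs from the background
    obtain ⟨q, hq, hqg⟩ : ∃ q, q < 2 ∧ (q = g ↔ ¬ J = true) := by
      cases J
      · exact ⟨g, hg, by simp⟩
      · exact ⟨1 - g, by omega, by simp; omega⟩
    let idx : ℕ → ℕ := fun v =>
      if v < #S then
        (if pos v + 1 ∉ S ∧ pos v + 1 < n then 2 * (pos v + 1) + q else 2 * pos v + (1 - q))
      else (if 1 ≤ pos v ∧ pos v - 1 ∈ S then 2 * pos v + q else 2 * pos v + (1 - q))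
    have iX : ∀ v, v < #S → idx v =
        (if pos v + 1 ∉ S ∧ pos v + 1 < n then 2 * (pos v + 1) + q else 2 * pos v + (1 - q)) :=
      fun v hv => if_pos hv
    have iY : ∀ v, #S ≤ v → idx v =
        (if 1 ≤ pos v ∧ pos v - 1 ∈ S then 2 * pos v + q else 2 * pos v + (1 - q)) :=
      fun v hv => if_neg (by omega)
    have hSn : ∀ x ∈ S, x < n := fun x hx => mem_range.1 (hS hx)
    obtain ⟨H, h1, h2, h3⟩ := hG n #S idx hle
      (fun v hv => by
        have := hp.lt v hv
        by_cases hvS : v < #S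
        · rw [iX v hvS]; split_ifs <;> omega
        · rw [iY v (by omega)]; split_ifs <;> omega)
      (fun u v hu hv huv => by
        have h1 := hp.monoX u v hu hv huv
        have h2 := hp.memX u hu
        have h3 := hp.memX v hv
        rw [iX u hu, iX v hv]
        by_cases e : pos v = pos u + 1
        · rw [← e]
          split_ifs <;> first | omega | tauto
        · split_ifs <;> omega)
      (fun u v hu huv hv => by
        have h1 := hp.monoY u v hu huv hv
        rw [iY u hu, iY v (by omega)]
        split_ifs <;> omega)
    have h4 : ∀ u v, u < #S → #S ≤ v → v < n →
        (pos v = pos u + 1 ↔ (aN H u v ↔ ¬ J = true)) := by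
      intro u v hu hv hvn
      have a1 := hp.memX u hu
      have a2 := hp.memY v hv hvn
      have a3 := hp.lt v hvn
      have e1 : pos v = pos u + 1 ↔ (idx u = idx v ∧ idx u % 2 = q) := by
        rw [iX u hu, iY v hv]
        constructor
        · intro e
          rw [if_pos ⟨by rw [← e]; exact a2, by omega⟩, if_pos ⟨by omega, by rw [e]; exact a1⟩]
          omega
        · split_ifs <;> omega
      rw [e1, h3 u v hu hv hvn]
      have e2 : (idx u % 2 = q) ↔ (idx u % 2 = g ↔ ¬ J = true) := by
        cases J <;> simp at hqg ⊢ <;> omega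
      rw [e2]
      cases J <;> simp at hqg ⊢ <;> omega
    refine ⟨H, pos, h1, hp, h2, h4, ?_⟩
    intro u v hu hv hvn
    constructor
    · intro huv
      have hne : ({t ∈ S | t < pos v}).Nonempty := ⟨pos u, by simp [hp.memX u hu, huv]⟩
      obtain ⟨p, hpm, hpmax⟩ := exists_max_image _ (fun t => t) hne
      simp only [mem_filter] at hpm hpmax
      have hvn' := hp.lt v hvn
      obtain ⟨u', hu', hu'p⟩ := hp.surj p (by omega)
      obtain ⟨v', hv', hv'p⟩ := hp.surj (p + 1) (by omega)
      have hu'S : u' < #S := by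
        by_contra hc
        exact hp.memY u' (by omega) hu' (hu'p ▸ hpm.1)
      have hv'S : #S ≤ v' := by
        by_contra hc
        have hm1 := hp.memX v' (by omega)
        rw [hv'p] at hm1
        by_cases e : p + 1 = pos v
        · exact hp.memY v hv hvn (e ▸ hm1)
        · have := hpmax (p + 1) ⟨hm1, by omega⟩
          omega
      refine ⟨u', v', hu'S, hv'S, ?_, ?_, (h4 u' v' hu'S hv'S hv').1 (by omega)⟩
      · by_contra hc
        have := hp.monoY v v' hv (by omega) hv'
        omega
      · intro hc
        have := hp.monoX u' u hu'S hu hc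
        have := hpmax (pos u) ⟨hp.memX u hu, huv⟩
        omega
    · rintro ⟨u', v', hu', hv', hle', hd, hA⟩
      have e := (h4 u' v' hu' hv' (by omega)).2 hA
      have b1 : pos v' ≤ pos v := by
        rcases Nat.lt_or_eq_of_le hle' with h | h
        · exact (hp.monoY v' v hv' h hvn).le
        · rw [h]
      have b2 : ¬ pos u' < pos u := by rw [hp.lt_iff u' u hu' hu]; exact hd
      omega
  by_cases hI : I1 = J
  · refine core G n 0 (by omega) I1 d (fun H b u v =>
      ∃ u' v', u' < b ∧ b ≤ v' ∧ v' ≤ v ∧ ¬ dlt d u' u ∧ (aN H u' v' ↔ ¬ J = true)) ?_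
    intro S hS h0
    obtain ⟨H, pos, h1, hp, h2, h4, h5⟩ := main S hS
    refine ⟨H, pos, h1, hp, h2, ?_, h5⟩
    intro hlt
    have hv : pos #S ≠ 0 := fun e => hp.memY #S le_rfl hlt (e ▸ h0)
    have hv' := hp.lt #S hlt
    obtain ⟨u, hu, hup⟩ := hp.surj (pos #S - 1) (by omega)
    have huS : u < #S := by
      by_contra hc
      rcases Nat.lt_or_eq_of_le (not_lt.1 hc) with h | h
      · have := hp.monoY #S u le_rfl h hu
        omega
      · rw [← h] at hup; omega
    exact ⟨u, huS, hI ▸ (h4 u #S huS le_rfl hlt).1 (by omega)⟩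
  · refine core G n (n - 1) (by omega) I1 d (fun H b u v =>
      ∃ u' v', u' < b ∧ b ≤ v' ∧ v' ≤ v ∧ ¬ dlt d u' u ∧ (aN H u' v' ↔ ¬ J = true)) ?_
    intro S hS h0
    obtain ⟨H, pos, h1, hp, h2, h4, h5⟩ := main S hS
    refine ⟨H, pos, h1, hp, h2, ?_, h5⟩
    intro hlt
    obtain ⟨u, hu, hup⟩ := hp.surj (n - 1) (by omega)
    have huS : u < #S := by
      by_contra hc
      exact hp.memY u (by omega) hu (hup ▸ h0)
    have hv' := hp.lt #S hlt
    refine ⟨u, huS, ?_⟩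
    have := h4 u #S huS le_rfl hlt
    have hne : ¬ (pos #S = pos u + 1) := by omega
    cases I1 <;> cases J <;> simp at hI this ⊢ <;> tauto

lemma good_count {m : ℕ} {G : SimpleGraph (Fin (2 * m))} {d I1 J2 J3 : Bool} {g : ℕ} (hg : g < 2)
    (hG : Good m G d I1 J2 J3 g) (n : ℕ) (hm : n ^ 2 + n ≤ m) :
    2 ^ (n - 1) ≤ numSub G n := by
  rcases Nat.eq_zero_or_pos n with rfl | hn
  · obtain ⟨H, hH, -⟩ := hG 0 0 id le_rfl (by simp) (by simp) (by omega)
    have : 0 < numSub G 0 := (Set.ncard_pos (Set.toFinite _)).2 ⟨H, hH⟩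
    simpa using Nat.succ_le_of_lt this
  · have h2 : 2 * n ≤ m := by nlinarith
    by_cases hJ : J2 = J3
    · subst hJ
      exact match_case hg hG n hn h2
    · exact half_case hG n hn h2 hJ

/-- **Lemma (counting subgraphs of `M_I`).**  If `|X| = |Y| = m ≥ n² + n` then
`M^<_I(X,Y)` and `M^>_I(X,Y)` each have at least `2^{n-1}` pairwise non-isomorphic
induced ordered subgraphs of order `n`. -/
theorem M_graphs_many_subgraphs (n m : ℕ) (hm : n ^ 2 + n ≤ m) (I1 I2 I3 I4 : Bool) :
    2 ^ (n - 1) ≤ numSub (Mlt m I1 I2 I3 I4) n ∧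
    2 ^ (n - 1) ≤ numSub (Mgt m I1 I2 I3 I4) n := by
  exact ⟨good_count (by omega) (good_lt m I1 I2 I3 I4) n hm,
    good_count (by omega) (good_gt m I1 I2 I3 I4) n hm⟩
end

section
/- Let P be a hereditary property of ordered graphs. Suppose that for arbitrarily large values of k ∈ ℕ, some graph in P contains a k-structure of Type 1 or a k-structure of Type 2. Then |P_n| ≥ 2^{n-1} for every n ∈ ℕ. -/
open Finset

/-- Many distinct induced subgraphs. -/
def RichT {N : ℕ} (G : SimpleGraph (Fin N)) (m : ℕ) : Prop :=
  ∃ φ : (Fin m → Bool) → (Fin (m + 1) ↪o Fin N), Function.Injective (fun s => G.comap (φ s))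

theorem RichT.of_compl {N : ℕ} {G : SimpleGraph (Fin N)} {m : ℕ} (h : RichT Gᶜ m) : RichT G m := by
  obtain ⟨φ, hφ⟩ := h
  refine ⟨φ, fun s t hst => hφ ?_⟩
  have key : ∀ s, Gᶜ.comap (φ s) = (G.comap (φ s))ᶜ := by
    intro s
    ext i j
    simp [SimpleGraph.compl_adj]
  simp only [key]
  simp only at hst
  rw [hst]

theorem ramseyA {C : Type} [Fintype C] [DecidableEq C] [Nonempty C] (m : ℕ) :
    ∃ K : ℕ, ∀ S : Finset ℕ, K ≤ S.card → ∀ c : ℕ → ℕ → C, ∃ (g : ℕ → ℕ) (col : ℕ → C),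
      (∀ i j, i < j → j < m → g i < g j) ∧ (∀ i, i < m → g i ∈ S) ∧
      (∀ i j, i < j → j < m → c (g i) (g j) = col i) := by
  induction m with
  | zero =>
    refine ⟨0, fun S _ c => ⟨id, fun _ => Classical.arbitrary C, ?_, ?_, ?_⟩⟩ <;> intros <;> omega
  | succ m ih =>
    obtain ⟨K, hK⟩ := ih
    refine ⟨Fintype.card C * K + 1, fun S hS c => ?_⟩
    have hne : S.Nonempty := Finset.card_pos.1 (by omega)
    set a := S.min' hne with ha
    have hcard : (S.erase a).card = S.card - 1 := Finset.card_erase_of_mem (Finset.min'_mem _ _)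
    obtain ⟨y, -, hy⟩ := Finset.exists_le_card_fiber_of_mul_le_card_of_maps_to
      (s := S.erase a) (t := (Finset.univ : Finset C)) (f := c a) (n := K)
      (fun _ _ => Finset.mem_univ _) Finset.univ_nonempty
      (by rw [Finset.card_univ, hcard]; omega)
    obtain ⟨g, col, h1, h2, h3⟩ := hK _ hy c
    have h2' : ∀ i, i < m → a < g i ∧ g i ∈ S ∧ c a (g i) = y := by
      intro i hi
      have := h2 i hi
      simp only [Finset.mem_filter, Finset.mem_erase] at this
      refine ⟨lt_of_le_of_ne (Finset.min'_le _ _ this.1.2) (Ne.symm this.1.1), this.1.2, this.2⟩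
    refine ⟨fun i => Nat.casesOn i a g, fun i => Nat.casesOn i y col, ?_, ?_, ?_⟩
    · rintro (_ | i) (_ | j) hij hj
      · omega
      · exact (h2' j (by omega)).1
      · omega
      · exact h1 i j (by omega) (by omega)
    · rintro (_ | i) hi
      · exact Finset.min'_mem _ _
      · exact (h2' i (by omega)).2.1
    · rintro (_ | i) (_ | j) hij hj
      · omega
      · exact (h2' j (by omega)).2.2
      · omega
      · exact h3 i j (by omega) (by omega)

theorem ramseyB (C : Type) [Fintype C] [DecidableEq C] [Nonempty C] (m : ℕ) :
    ∃ K : ℕ, ∀ c : ℕ → ℕ → C, ∃ (g : ℕ → ℕ) (col : C),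
      (∀ i j, i < j → j < m → g i < g j) ∧ (∀ i, i < m → g i < K) ∧
      (∀ i j, i < j → j < m → c (g i) (g j) = col) := by
  obtain ⟨K, hK⟩ := ramseyA (C := C) (Fintype.card C * m)
  refine ⟨K, fun c => ?_⟩
  obtain ⟨g, col, h1, h2, h3⟩ := hK (Finset.range K) (by simp) c
  obtain ⟨y, -, hy⟩ := Finset.exists_le_card_fiber_of_mul_le_card_of_maps_to
      (s := Finset.range (Fintype.card C * m)) (t := (Finset.univ : Finset C)) (f := col) (n := m)
      (fun _ _ => Finset.mem_univ _) Finset.univ_nonempty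
      (by rw [Finset.card_univ, Finset.card_range])
  obtain ⟨T, hT, hTc⟩ := Finset.exists_subset_card_eq hy
  let e := T.orderEmbOfFin hTc
  have he : ∀ i, e i < Fintype.card C * m ∧ col (e i) = y := by
    intro i
    have := hT (Finset.orderEmbOfFin_mem T hTc i)
    simpa using this
  refine ⟨fun i => if h : i < m then g (e ⟨i, h⟩) else 0, y, ?_, ?_, ?_⟩
  · intro i j hij hj
    have hi : i < m := by omega
    simp only [hi, hj, dif_pos]
    exact h1 _ _ (e.strictMono (by simpa using hij)) (he _).1
  · intro i hi
    simp only [hi, dif_pos]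
    simpa using h2 _ (he ⟨i, hi⟩).1
  · intro i j hij hj
    have hi : i < m := by omega
    simp only [hi, hj, dif_pos]
    rw [h3 _ _ (e.strictMono (by simpa using hij)) (he _).1]
    exact (he _).2

/-- Type 1 gives many subgraphs. -/
theorem rich_type1 {N : ℕ} (G : SimpleGraph (Fin N)) (m : ℕ) (y : Fin N) (u v : ℕ → Fin N)
    (huv : ∀ i j, i < j → j < m → u i < u j ∧ u i < v j ∧ v i < u j ∧ v i < v j)
    (hy : (∀ i, i < m → y < u i ∧ y < v i) ∨ (∀ i, i < m → u i < y ∧ v i < y))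
    (hu : ∀ i, i < m → G.Adj y (u i)) (hv : ∀ i, i < m → ¬ G.Adj y (v i)) : RichT G m := by
  let z : (Fin m → Bool) → Fin m → Fin N := fun s i => if s i then u i else v i
  have hz : ∀ s, StrictMono (z s) := by
    intro s i j hij
    have := huv i j hij j.2
    simp only [z]
    split_ifs <;> tauto
  have hadj : ∀ s i, G.Adj y (z s i) ↔ s i = true := by
    intro s i
    simp only [z]
    have h1 := hu i i.2
    have h2 := hv i i.2
    split_ifs with h <;> simp [h, h1, h2]
  rcases hy with hy | hy
  · have hm : ∀ s, StrictMono (Fin.cons y (z s) : Fin (m + 1) → Fin N) := by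
      intro s i j
      refine Fin.cases ?_ (fun i => ?_) i <;> refine Fin.cases ?_ (fun j => ?_) j <;> intro hij
      · simp at hij
      · have := hy j j.2
        simp only [Fin.cons_zero, Fin.cons_succ, z]
        split_ifs <;> tauto
      · simp at hij
      · simpa using hz s (by simpa using hij)
    refine ⟨fun s => OrderEmbedding.ofStrictMono _ (hm s), fun s t hst => ?_⟩
    funext i
    have := congrArg (fun H : SimpleGraph (Fin (m + 1)) => H.Adj 0 i.succ) hst
    simp [hadj] at this
    exact this
  · have hm : ∀ s, StrictMono (Fin.snoc (z s) y : Fin (m + 1) → Fin N) := by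
      intro s i j
      refine Fin.lastCases ?_ (fun i => ?_) i <;> refine Fin.lastCases ?_ (fun j => ?_) j <;> intro hij
      · simp at hij
      · exact absurd hij (not_lt.2 (Fin.le_last _))
      · have := hy i i.2
        simp only [Fin.snoc_last, Fin.snoc_castSucc, z]
        split_ifs <;> tauto
      · simpa using hz s (by simpa using hij)
    refine ⟨fun s => OrderEmbedding.ofStrictMono _ (hm s), fun s t hst => ?_⟩
    funext i
    have := congrArg (fun H : SimpleGraph (Fin (m + 1)) => H.Adj (Fin.last m) i.castSucc) hst
    simp [hadj] at this
    exact this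

/-- Sorted data of a word. -/
structure SData {n : ℕ} (I1 I4 : Prop) (C : ℕ → ℕ → Prop) (d : Prop) (w : Fin n → Bool)
    (H : SimpleGraph (Fin n)) (σ : Equiv.Perm (Fin n)) : Prop where
  low : ∀ p q, w (σ p) = true → w (σ q) = false → p < q
  xo : ∀ p q, w (σ p) = true → w (σ q) = true → (σ p < σ q ↔ p < q)
  yo : ∀ p q, w (σ p) = false → w (σ q) = false → (σ p < σ q ↔ ((d ∧ p < q) ∨ (¬ d ∧ q < p)))
  xa : ∀ p q, w (σ p) = true → w (σ q) = true → p ≠ q → (H.Adj p q ↔ I1)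
  ya : ∀ p q, w (σ p) = false → w (σ q) = false → p ≠ q → (H.Adj p q ↔ I4)
  ca : ∀ p q, w (σ p) = true → w (σ q) = false → (H.Adj p q ↔ C (σ p) (σ q))

theorem exists_peak {n : ℕ} (w : Fin n → Bool) (i j : Fin n) (hij : i < j) (hi : w i = true)
    (hj : w j = false) : ∃ k l : Fin n, i ≤ k ∧ (l : ℕ) = k + 1 ∧ l ≤ j ∧ w k = true ∧ w l = false := by
  have key : ∀ m : ℕ, ∀ j : Fin n, (j : ℕ) = i + 1 + m → w j = false →
      ∃ k l : Fin n, i ≤ k ∧ (l : ℕ) = k + 1 ∧ l ≤ j ∧ w k = true ∧ w l = false := by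
    intro m
    induction m with
    | zero => intro j h1 h2; exact ⟨i, j, le_rfl, h1, le_rfl, hi, h2⟩
    | succ m ih =>
      intro j h1 h2
      have hlt : i + 1 + m < n := by omega
      cases h : w ⟨i + 1 + m, hlt⟩ with
      | true =>
        exact ⟨⟨i + 1 + m, hlt⟩, j, by rw [Fin.le_def]; simp; omega, by simp; omega, le_rfl, h, h2⟩
      | false =>
        obtain ⟨k, l, a, b, c, e⟩ := ih ⟨i + 1 + m, hlt⟩ rfl h
        refine ⟨k, l, a, b, ?_, e⟩
        rw [Fin.le_def] at c ⊢
        simp at c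
        omega
  have hij' : (i : ℕ) < j := hij
  exact key (j - i - 1) j (by omega) hj

/-- Step 1: the split point is determined. -/
theorem SData.split {n : ℕ} {I1 I4 : Prop} {C : ℕ → ℕ → Prop} {d : Prop} {w w' : Fin (n + 1) → Bool}
    {H : SimpleGraph (Fin (n + 1))} {σ σ' : Equiv.Perm (Fin (n + 1))}
    (hS : SData I1 I4 C d w H σ) (hS' : SData I1 I4 C d w' H σ')
    (hC1 : ∀ i, C i (i + 1)) (hC2 : ∀ i j, j ≤ i → ¬ C i j)
    (hcase : (¬ I1 ∧ ¬ I4 ∧ w (Fin.last n) = false ∧ w' (Fin.last n) = false) ∨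
      (I1 ∧ w (Fin.last n) = true ∧ w' (Fin.last n) = true) ∨
      (I4 ∧ w 0 = false ∧ w' 0 = false)) (p : Fin (n + 1)) (hp : w (σ p) = true) :
    w' (σ' p) = true := by
  by_contra hp'
  have hp' : w' (σ' p) = false := by simpa using hp'
  have up' : ∀ q, p ≤ q → w' (σ' q) = false := by
    intro q hq
    by_contra h
    have := hS'.low q p (by simpa using h) hp'
    exact absurd this (not_lt.2 hq)
  rcases hcase with ⟨h1, h4, hl, hl'⟩ | ⟨h1, hl, hl'⟩ | ⟨h4, hl, hl'⟩
  · obtain ⟨k, l, hk, hkl, -, wk, wl⟩ := exists_peak w (σ p) (Fin.last n)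
      (lt_of_le_of_ne (Fin.le_last _) (fun h => by rw [h, hl] at hp; simp at hp)) hp hl
    obtain ⟨k, rfl⟩ := σ.surjective k
    obtain ⟨l, rfl⟩ := σ.surjective l
    have hpk : p ≤ k := by
      by_contra h
      exact absurd ((hS.xo k p wk hp).2 (not_le.1 h)) (not_lt.2 hk)
    have hkl' := hS.low k l wk wl
    have hadj : H.Adj k l := (hS.ca k l wk wl).2 (by rw [hkl]; exact hC1 _)
    exact h4 ((hS'.ya k l (up' k hpk) (up' l (hpk.trans hkl'.le)) hkl'.ne).1 hadj)
  · obtain ⟨r, hr⟩ := σ'.surjective (Fin.last n)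
    rw [← hr] at hl'
    have hrp := hS'.low r p hl' hp'
    have wr : w (σ r) = true := by
      by_contra h
      exact absurd (hS.low p r hp (by simpa using h)) (not_lt.2 hrp.le)
    have hadj := (hS.xa r p wr hp hrp.ne).2 h1
    refine hC2 _ _ ?_ ((hS'.ca r p hl' hp').1 hadj)
    rw [hr]
    exact Fin.le_last (σ' p)
  · obtain ⟨r, hr⟩ := σ.surjective 0
    rw [← hr] at hl
    have hpr := hS.low p r hp hl
    have hadj := (hS'.ya p r hp' (up' r hpr.le) hpr.ne).2 h4
    refine hC2 _ _ ?_ ((hS.ca p r hp hl).1 hadj)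
    rw [hr]
    simp

theorem SData.eq_of_split {n : ℕ} {I1 I4 : Prop} {C : ℕ → ℕ → Prop} {d : Prop} {w w' : Fin n → Bool}
    {H : SimpleGraph (Fin n)} {σ σ' : Equiv.Perm (Fin n)}
    (hS : SData I1 I4 C d w H σ) (hS' : SData I1 I4 C d w' H σ')
    (hC : (∀ i j, C i j ↔ i < j) ∨ (∀ i j, C i j ↔ j = i + 1))
    (hA : ∀ p, w (σ p) = w' (σ' p)) : ∀ i, w i = true → w' i = true := by
  have xo' : ∀ p q, w (σ p) = true → w (σ q) = true → (σ p < σ q ↔ σ' p < σ' q) := by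
    intro p q hp hq
    rw [hS.xo p q hp hq, hS'.xo p q (by rw [← hA, hp]) (by rw [← hA, hq])]
  have yo' : ∀ p q, w (σ p) = false → w (σ q) = false → (σ p < σ q ↔ σ' p < σ' q) := by
    intro p q hp hq
    rw [hS.yo p q hp hq, hS'.yo p q (by rw [← hA, hp]) (by rw [← hA, hq])]
  have ca' : ∀ p q, w (σ p) = true → w (σ q) = false → (C (σ p) (σ q) ↔ C (σ' p) (σ' q)) := by
    intro p q hp hq
    rw [← hS.ca p q hp hq, ← hS'.ca p q (by rw [← hA, hp]) (by rw [← hA, hq])]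
  have co : ∀ p q, w (σ p) = true → w (σ q) = false → (σ p < σ q ↔ σ' p < σ' q) := by
    rcases hC with hC | hC
    · intro p q hp hq
      simpa [hC] using ca' p q hp hq
    · simp only [hC] at ca'
      intro p q hp hq
      constructor
      · intro h
        obtain ⟨k, l, hk, hkl, hl, wk, wl⟩ := exists_peak w _ _ h hp hq
        obtain ⟨k, rfl⟩ := σ.surjective k
        obtain ⟨l, rfl⟩ := σ.surjective l
        have e1 := (ca' k l wk wl).1 hkl
        have e2 : σ' p ≤ σ' k := not_lt.1 (fun h => absurd ((xo' k p wk hp).2 h) (not_lt.2 hk))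
        have e3 : σ' l ≤ σ' q := not_lt.1 (fun h => absurd ((yo' q l hq wl).2 h) (not_lt.2 hl))
        rw [Fin.lt_def]
        rw [Fin.le_def] at e2 e3
        omega
      · intro h
        obtain ⟨k, l, hk, hkl, hl, wk, wl⟩ := exists_peak w' _ _ h (by rw [← hA, hp]) (by rw [← hA, hq])
        obtain ⟨k, rfl⟩ := σ'.surjective k
        obtain ⟨l, rfl⟩ := σ'.surjective l
        rw [← hA] at wk wl
        have e1 := (ca' k l wk wl).2 hkl
        have e2 : σ p ≤ σ k := not_lt.1 (fun h => absurd ((xo' k p wk hp).1 h) (not_lt.2 hk))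
        have e3 : σ l ≤ σ q := not_lt.1 (fun h => absurd ((yo' q l hq wl).1 h) (not_lt.2 hl))
        rw [Fin.lt_def]
        rw [Fin.le_def] at e2 e3
        omega
  have hcount : ∀ (τ : Equiv.Perm (Fin n)) (p : Fin n),
      (Finset.univ.filter (fun r => τ r < τ p)).card = τ p := by
    intro τ p
    rw [← Fin.card_Iio (τ p)]
    apply Finset.card_bij (fun r _ => τ r)
    · intro r hr; simpa using hr
    · intro a _ b _ h; exact τ.injective h
    · intro b hb
      exact ⟨τ.symm b, by simpa using hb, by simp⟩
  have hσ : ∀ p, w (σ p) = true → σ p = σ' p := by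
    intro p hp
    apply Fin.ext
    rw [← hcount σ p, ← hcount σ' p]
    congr 1
    ext r
    simp only [Finset.mem_filter, Finset.mem_univ, true_and]
    cases hr : w (σ r) with
    | true => exact xo' r p hr hp
    | false =>
      have hne : r ≠ p := fun h => by rw [h, hp] at hr; simp at hr
      have n1 : σ r ≠ σ p := fun h => hne (σ.injective h)
      have n2 : σ' r ≠ σ' p := fun h => hne (σ'.injective h)
      have := co p r hp hr
      rw [← not_iff_not, not_lt, not_lt, n1.symm.le_iff_lt, n2.symm.le_iff_lt]
      exact this
  intro i hi
  obtain ⟨p, rfl⟩ := σ.surjective i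
  rw [hσ p hi, ← hA, hi]

/-- The core counting statement. -/
theorem rich_core {N n : ℕ} (G : SimpleGraph (Fin N)) (I1 I4 : Prop) (C : ℕ → ℕ → Prop) (d : Prop)
    (hC : (∀ i j, C i j ↔ i < j) ∨ (∀ i j, C i j ↔ j = i + 1))
    (V : (Fin (n + 1) → Bool) → Fin (n + 1) → Fin N)
    (hXY : ∀ w i j, w i = true → w j = false → V w i < V w j)
    (hX : ∀ w i j, w i = true → w j = true → i < j → V w i < V w j)
    (hY : ∀ w i j, w i = false → w j = false → i < j → (d ∧ V w i < V w j) ∨ (¬ d ∧ V w j < V w i))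
    (h1 : ∀ w i j, w i = true → w j = true → i < j → (G.Adj (V w i) (V w j) ↔ I1))
    (h4 : ∀ w i j, w i = false → w j = false → i < j → (G.Adj (V w i) (V w j) ↔ I4))
    (hc : ∀ w i j, w i = true → w j = false → (G.Adj (V w i) (V w j) ↔ C i j)) : RichT G n := by
  have hVinj : ∀ w, Function.Injective (V w) := by
    intro w
    have key : ∀ i j, i < j → V w i ≠ V w j := by
      intro i j hij
      cases hi : w i <;> cases hj : w j
      · rcases hY w i j hi hj hij with h | h
        · exact h.2.ne
        · exact h.2.ne'
      · exact (hXY w j i hj hi).ne'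
      · exact (hXY w i j hi hj).ne
      · exact (hX w i j hi hj hij).ne
    intro i j h
    rcases lt_trichotomy i j with h' | h' | h'
    · exact absurd h (key i j h')
    · exact h'
    · exact absurd h.symm (key j i h')
  have hmono : ∀ w, StrictMono (V w ∘ Tuple.sort (V w)) := fun w =>
    (Tuple.monotone_sort (V w)).strictMono_of_injective
      ((hVinj w).comp (Equiv.injective _))
  let ψ : (Fin (n + 1) → Bool) → (Fin (n + 1) ↪o Fin N) :=
    fun w => OrderEmbedding.ofStrictMono _ (hmono w)
  have hψ : ∀ w p, ψ w p = V w (Tuple.sort (V w) p) := fun w p => rfl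
  have hlt : ∀ w p q, V w (Tuple.sort (V w) p) < V w (Tuple.sort (V w) q) ↔ p < q :=
    fun w p q => (hmono w).lt_iff_lt
  have hSD : ∀ w, SData I1 I4 C d w (G.comap (ψ w)) (Tuple.sort (V w)) := by
    intro w
    set σ := Tuple.sort (V w) with hσ
    refine ⟨?_, ?_, ?_, ?_, ?_, ?_⟩
    · intro p q hp hq
      exact (hlt w p q).1 (hXY w _ _ hp hq)
    · have key : ∀ p q, w (σ p) = true → w (σ q) = true → (σ p < σ q → p < q) :=
        fun p q hp hq h => (hlt w p q).1 (hX w _ _ hp hq h)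
      intro p q hp hq
      refine ⟨key p q hp hq, fun h => ?_⟩
      by_contra h'
      have : σ q < σ p := lt_of_le_of_ne (not_lt.1 h') (fun e => h.ne' (σ.injective e))
      exact absurd (key q p hq hp this) (not_lt.2 h.le)
    · have key : ∀ p q, w (σ p) = false → w (σ q) = false → (σ p < σ q → ((d ∧ p < q) ∨ (¬ d ∧ q < p))) := by
        intro p q hp hq h
        rw [← hlt w p q, ← hlt w q p]
        exact hY w _ _ hp hq h
      intro p q hp hq
      refine ⟨key p q hp hq, fun h => ?_⟩
      by_contra h'
      have hne : p ≠ q := by rintro rfl; simp at h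
      have : σ q < σ p := lt_of_le_of_ne (not_lt.1 h') (fun e => hne (σ.injective e).symm)
      rcases key q p hq hp this with h2 | h2 <;> rcases h with h | h
      · exact absurd h.2 (not_lt.2 h2.2.le)
      · exact h.1 h2.1
      · exact h2.1 h.1
      · exact absurd h.2 (not_lt.2 h2.2.le)
    · intro p q hp hq hne
      have hne' : σ p ≠ σ q := fun h => hne (σ.injective h)
      simp only [SimpleGraph.comap_adj, hψ]
      rcases lt_or_gt_of_ne hne' with h | h
      · exact h1 w _ _ hp hq h
      · rw [G.adj_comm]; exact h1 w _ _ hq hp h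
    · intro p q hp hq hne
      have hne' : σ p ≠ σ q := fun h => hne (σ.injective h)
      simp only [SimpleGraph.comap_adj, hψ]
      rcases lt_or_gt_of_ne hne' with h | h
      · exact h4 w _ _ hp hq h
      · rw [G.adj_comm]; exact h4 w _ _ hq hp h
    · intro p q hp hq
      exact hc w _ _ hp hq
  have hC1 : ∀ i, C i (i + 1) := by
    intro i; rcases hC with h | h <;> rw [h]; omega
  have hC2 : ∀ i j, j ≤ i → ¬ C i j := by
    intro i j hij; rcases hC with h | h <;> rw [h] <;> omega
  have main : ∀ w w', G.comap (ψ w) = G.comap (ψ w') →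
      ((¬ I1 ∧ ¬ I4 ∧ w (Fin.last n) = false ∧ w' (Fin.last n) = false) ∨
      (I1 ∧ w (Fin.last n) = true ∧ w' (Fin.last n) = true) ∨
      (I4 ∧ w 0 = false ∧ w' 0 = false)) → w = w' := by
    intro w w' he hcase
    have S := hSD w
    have S' := hSD w'
    rw [← he] at S'
    have hA : ∀ p, w (Tuple.sort (V w) p) = w' (Tuple.sort (V w') p) := fun p =>
      Bool.eq_iff_iff.2 ⟨S.split S' hC1 hC2 hcase p, S'.split S hC1 hC2 (by tauto) p⟩
    funext i
    exact Bool.eq_iff_iff.2 ⟨S.eq_of_split S' hC hA i, S'.eq_of_split S hC (fun p => (hA p).symm) i⟩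
  by_cases hI1 : I1
  · refine ⟨fun s => ψ (Fin.snoc s true : Fin (n + 1) → Bool), fun s t hst => ?_⟩
    have := main _ _ hst (by simp [hI1])
    exact (Fin.snoc_injective2 this).1
  by_cases hI4 : I4
  · refine ⟨fun s => ψ (Fin.cons false s : Fin (n + 1) → Bool), fun s t hst => ?_⟩
    have := main _ _ hst (by simp [hI4])
    exact Fin.cons_right_injective _ this
  · refine ⟨fun s => ψ (Fin.snoc s false : Fin (n + 1) → Bool), fun s t hst => ?_⟩
    have := main _ _ hst (by simp [hI1, hI4])
    exact (Fin.snoc_injective2 this).1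

/-- Index of the `y`-vertex in the matching case. -/
def yIdx {n : ℕ} (w : Fin n → Bool) (i : Fin n) : ℕ :=
  if w ⟨i - 1, by omega⟩ = true then (i : ℕ) - 1 else i

theorem rich_hom {N n : ℕ} (G : SimpleGraph (Fin N)) (I1 I2 I3 I4 d : Prop) (x y : ℕ → Fin N)
    (hx : ∀ i j, i < j → j < n + 1 → x i < x j)
    (hy : ∀ i j, i < j → j < n + 1 → (d ∧ y i < y j) ∨ (¬ d ∧ y j < y i))
    (hxy : ∀ i j, i < n + 1 → j < n + 1 → x i < y j)
    (h1 : ∀ i j, i < j → j < n + 1 → (G.Adj (x i) (x j) ↔ I1))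
    (h2 : ∀ i j, i < j → j < n + 1 → (G.Adj (x i) (y j) ↔ I2))
    (h3 : ∀ i j, i < j → j < n + 1 → (G.Adj (y i) (x j) ↔ I3))
    (h4 : ∀ i j, i < j → j < n + 1 → (G.Adj (y i) (y j) ↔ I4))
    (hcase : (I2 ∧ ¬ I3) ∨ (¬ I2 ∧ ¬ I3 ∧ ∀ i, i < n + 1 → G.Adj (x i) (y i))) : RichT G n := by
  rcases hcase with ⟨t2, t3⟩ | ⟨t2, t3, hd⟩
  · refine rich_core G I1 I4 (fun i j => i < j) d (Or.inl fun _ _ => Iff.rfl)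
      (fun w i => if w i then x i else y i) ?_ ?_ ?_ ?_ ?_ ?_
    · intro w i j hi hj
      simp only [hi, hj]
      exact hxy _ _ i.2 j.2
    · intro w i j hi hj hij
      simp only [hi, hj]
      exact hx _ _ hij j.2
    · intro w i j hi hj hij
      simp only [hi, hj]
      exact hy _ _ hij j.2
    · intro w i j hi hj hij
      simp only [hi, hj]
      exact h1 _ _ hij j.2
    · intro w i j hi hj hij
      simp only [hi, hj]
      exact h4 _ _ hij j.2
    · intro w i j hi hj
      simp only [hi, hj]
      rcases lt_trichotomy i j with h | h | h
      · have := h2 _ _ h j.2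
        simpa [t2, h] using this
      · rw [h, hj] at hi; simp at hi
      · have := h3 _ _ h i.2
        rw [G.adj_comm] at this
        simp only [t3, iff_false] at this
        simp [this, h.le]
  · have hidx : ∀ (w : Fin (n + 1) → Bool) (i : Fin (n + 1)), yIdx w i < n + 1 := by
      intro w i; unfold yIdx; split_ifs <;> omega
    have hmono : ∀ (w : Fin (n + 1) → Bool) (i j : Fin (n + 1)), w i = false → w j = false → i < j →
        yIdx w i < yIdx w j := by
      intro w i j hi hj hij
      have hij' : (i : ℕ) < j := hij
      have e1 : yIdx w i ≤ i := by unfold yIdx; split_ifs <;> omega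
      by_cases h : (j : ℕ) = i + 1
      · have : yIdx w j = j := by
          have e : (⟨j - 1, by omega⟩ : Fin (n + 1)) = i := Fin.ext (by simp; omega)
          unfold yIdx
          rw [e]; simp [hi]
        omega
      · have : (j : ℕ) - 1 ≤ yIdx w j := by unfold yIdx; split_ifs <;> omega
        omega
    refine rich_core G I1 I4 (fun i j => j = i + 1) d (Or.inr fun _ _ => Iff.rfl)
      (fun w i => if w i then x i else y (yIdx w i)) ?_ ?_ ?_ ?_ ?_ ?_
    · intro w i j hi hj
      simp only [hi, hj]
      exact hxy _ _ i.2 (hidx _ _)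
    · intro w i j hi hj hij
      simp only [hi, hj]
      exact hx _ _ hij j.2
    · intro w i j hi hj hij
      simp only [hi, hj]
      exact hy _ _ (hmono w i j hi hj hij) (hidx _ _)
    · intro w i j hi hj hij
      simp only [hi, hj]
      exact h1 _ _ hij j.2
    · intro w i j hi hj hij
      simp only [hi, hj]
      exact h4 _ _ (hmono w i j hi hj hij) (hidx _ _)
    · intro w i j hi hj
      simp only [hi, hj]
      have e0 : (j : ℕ) = i + 1 ↔ (i : ℕ) = yIdx w j := by
        unfold yIdx
        by_cases hw : w ⟨j - 1, by omega⟩ = true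
        · rw [if_pos hw]
          have : (j : ℕ) ≠ 0 := by
            intro h
            have e : (⟨j - 1, by omega⟩ : Fin (n + 1)) = j := Fin.ext (by simp; omega)
            rw [e, hj] at hw; simp at hw
          omega
        · rw [if_neg hw]
          constructor
          · intro h
            have e : (⟨j - 1, by omega⟩ : Fin (n + 1)) = i := Fin.ext (by simp; omega)
            rw [e, hi] at hw; simp at hw
          · intro h
            have e : i = j := Fin.ext h
            rw [e, hj] at hi; simp at hi
      rw [e0]
      have := hidx w j
      simp only [if_true, Bool.false_eq_true, if_false]
      rcases lt_trichotomy (i : ℕ) (yIdx w j) with h | h | h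
      · have := h2 _ _ h (hidx _ _)
        simp only [t2] at this
        simp [this, h.ne]
      · rw [← h]
        simp [hd i i.2]
      · have := h3 _ _ h i.2
        rw [G.adj_comm] at this
        simp only [t3] at this
        simp [this, h.ne']

theorem exists_alt (k : ℕ) (D : ℕ → Prop) (hD : ∀ i, i + 1 < 2 * k → (D i ↔ ¬ D (i + 1))) :
    ∃ e f : ℕ → ℕ, ∀ p, p < k → (2 * p ≤ e p ∧ e p ≤ 2 * p + 1 ∧ 2 * p ≤ f p ∧ f p ≤ 2 * p + 1 ∧
      D (e p) ∧ ¬ D (f p)) := by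
  classical
  refine ⟨fun p => if D (2 * p) then 2 * p else 2 * p + 1,
    fun p => if D (2 * p) then 2 * p + 1 else 2 * p, fun p hp => ?_⟩
  have := hD (2 * p) (by omega)
  by_cases h : D (2 * p)
  · simp [h]; tauto
  · simp [h]; tauto

/-- extend a function on `Fin` to the natural numbers -/
theorem exists_ext {N K : ℕ} (hK : 0 < K) (x : Fin K → Fin N) :
    ∃ x' : ℕ → Fin N, ∀ i (h : i < K), x' i = x ⟨i, h⟩ :=
  ⟨fun i => if h : i < K then x ⟨i, h⟩ else x ⟨0, hK⟩, fun i h => by simp [h]⟩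

theorem rich_of_type1 {N k m : ℕ} (G : SimpleGraph (Fin N)) (hk : m + 1 ≤ k) (h : HasType1 G k) :
    RichT G m := by
  obtain ⟨y, x, hx, hy, ha⟩ := h
  obtain ⟨x', hx'⟩ := exists_ext (by omega) x
  obtain ⟨e, f, hef⟩ := exists_alt k (fun i => G.Adj y (x' i)) (by
    intro i hi
    rw [hx' i (by omega), hx' (i + 1) hi]
    exact ha _ _ rfl)
  have hm : ∀ i j, i < j → j < 2 * k → x' i < x' j := by
    intro i j hij hj
    rw [hx' i (by omega), hx' j hj]
    exact hx (by simpa using hij)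
  refine rich_type1 G m y (fun p => x' (e p)) (fun p => x' (f p)) ?_ ?_ ?_ ?_
  · intro i j hij hj
    have h1 := hef i (by omega)
    have h2 := hef j (by omega)
    refine ⟨hm _ _ ?_ ?_, hm _ _ ?_ ?_, hm _ _ ?_ ?_, hm _ _ ?_ ?_⟩ <;> omega
  · refine hy.imp ?_ ?_ <;> intro hy i hi <;> have h1 := hef i (by omega) <;>
      rw [hx' (e i) (by omega), hx' (f i) (by omega)] <;> exact ⟨hy _, hy _⟩
  · intro i hi; exact (hef i (by omega)).2.2.2.2.1
  · intro i hi; exact (hef i (by omega)).2.2.2.2.2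

theorem rich_of_type2 (m : ℕ) : ∃ K : ℕ, ∀ (k N : ℕ) (G : SimpleGraph (Fin N)), K ≤ k →
    HasType2 G k → RichT G m := by
  classical
  obtain ⟨K, hK⟩ := ramseyB (Fin 9 → Prop) (m + 1)
  refine ⟨K + 1, fun k N G hk h => ?_⟩
  obtain ⟨x, y, hx, hy, hxy, ha⟩ := h
  obtain ⟨x', hx'⟩ := exists_ext (by omega) x
  obtain ⟨y', hy'⟩ := exists_ext (by omega) y
  obtain ⟨e, f, hef⟩ := exists_alt k (fun i => G.Adj (x' i) (y' i)) (by
    intro i hi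
    rw [hx' i (by omega), hx' (i + 1) hi, hy' i (by omega), hy' (i + 1) hi]
    exact ha _ _ rfl)
  have hxm : ∀ i j, i < j → j < 2 * k → x' i < x' j := by
    intro i j hij hj
    rw [hx' i (by omega), hx' j hj]
    exact hx (by simpa using hij)
  have hym : ∃ d : Prop, ∀ i j, i < j → j < 2 * k → (d ∧ y' i < y' j) ∨ (¬ d ∧ y' j < y' i) := by
    rcases hy with hy | hy
    · refine ⟨True, fun i j hij hj => Or.inl ⟨trivial, ?_⟩⟩
      rw [hy' i (by omega), hy' j hj]
      exact hy (by simpa using hij)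
    · refine ⟨False, fun i j hij hj => Or.inr ⟨id, ?_⟩⟩
      rw [hy' i (by omega), hy' j hj]
      exact hy (by simpa using hij)
  obtain ⟨d, hym⟩ := hym
  have hxy' : ∀ i j, i < 2 * k → j < 2 * k → x' i < y' j := by
    intro i j hi hj
    rw [hx' i hi, hy' j hj]
    exact hxy _ _
  obtain ⟨g, col, hg, hgK, hcol⟩ := hK (fun p q =>
    ![G.Adj (x' (e p)) (x' (e q)), G.Adj (x' (e p)) (y' (e q)), G.Adj (y' (e p)) (x' (e q)),
      G.Adj (y' (e p)) (y' (e q)),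
      G.Adj (x' (f p)) (x' (f q)), G.Adj (x' (f p)) (y' (f q)), G.Adj (y' (f p)) (x' (f q)),
      G.Adj (y' (f p)) (y' (f q)), G.Adj (x' (e p)) (y' (f q))])
  have hc : ∀ t : Fin 9, ∀ i j, i < j → j < m + 1 → _ = col t :=
    fun t i j hij hj => congrFun (hcol i j hij hj) t
  have c0 : ∀ i j, i < j → j < m + 1 → (G.Adj (x' (e (g i))) (x' (e (g j))) ↔ col 0) :=
    fun i j hij hj => Iff.of_eq (hc 0 i j hij hj)
  have c1 : ∀ i j, i < j → j < m + 1 → (G.Adj (x' (e (g i))) (y' (e (g j))) ↔ col 1) :=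
    fun i j hij hj => Iff.of_eq (hc 1 i j hij hj)
  have c2 : ∀ i j, i < j → j < m + 1 → (G.Adj (y' (e (g i))) (x' (e (g j))) ↔ col 2) :=
    fun i j hij hj => Iff.of_eq (hc 2 i j hij hj)
  have c3 : ∀ i j, i < j → j < m + 1 → (G.Adj (y' (e (g i))) (y' (e (g j))) ↔ col 3) :=
    fun i j hij hj => Iff.of_eq (hc 3 i j hij hj)
  have c4 : ∀ i j, i < j → j < m + 1 → (G.Adj (x' (f (g i))) (x' (f (g j))) ↔ col 4) :=
    fun i j hij hj => Iff.of_eq (hc 4 i j hij hj)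
  have c5 : ∀ i j, i < j → j < m + 1 → (G.Adj (x' (f (g i))) (y' (f (g j))) ↔ col 5) :=
    fun i j hij hj => Iff.of_eq (hc 5 i j hij hj)
  have c6 : ∀ i j, i < j → j < m + 1 → (G.Adj (y' (f (g i))) (x' (f (g j))) ↔ col 6) :=
    fun i j hij hj => Iff.of_eq (hc 6 i j hij hj)
  have c7 : ∀ i j, i < j → j < m + 1 → (G.Adj (y' (f (g i))) (y' (f (g j))) ↔ col 7) :=
    fun i j hij hj => Iff.of_eq (hc 7 i j hij hj)
  have c8 : ∀ i j, i < j → j < m + 1 → (G.Adj (x' (e (g i))) (y' (f (g j))) ↔ col 8) :=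
    fun i j hij hj => Iff.of_eq (hc 8 i j hij hj)
  have hb : ∀ i, i < m + 1 → (2 * g i ≤ e (g i) ∧ e (g i) ≤ 2 * g i + 1 ∧ 2 * g i ≤ f (g i) ∧
      f (g i) ≤ 2 * g i + 1 ∧ g i < k) := by
    intro i hi
    have h1 := hgK i hi
    have h2 := hef (g i) (by omega)
    exact ⟨h2.1, h2.2.1, h2.2.2.1, h2.2.2.2.1, by omega⟩
  -- generic application of the homogeneous lemma
  have gen : ∀ (r : ℕ → ℕ) (J1 J2 J3 J4 : Prop),
      (∀ i, i < m + 1 → 2 * g i ≤ r i ∧ r i ≤ 2 * g i + 1) →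
      (∀ i j, i < j → j < m + 1 → (G.Adj (x' (r i)) (x' (r j)) ↔ J1)) →
      (∀ i j, i < j → j < m + 1 → (G.Adj (x' (r i)) (y' (r j)) ↔ J2)) →
      (∀ i j, i < j → j < m + 1 → (G.Adj (y' (r i)) (x' (r j)) ↔ J3)) →
      (∀ i j, i < j → j < m + 1 → (G.Adj (y' (r i)) (y' (r j)) ↔ J4)) →
      ((J2 ∧ ¬ J3) ∨ (¬ J2 ∧ J3) ∨ (¬ J2 ∧ ¬ J3 ∧ ∀ i, i < m + 1 → G.Adj (x' (r i)) (y' (r i))) ∨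
        (J2 ∧ J3 ∧ ∀ i, i < m + 1 → ¬ G.Adj (x' (r i)) (y' (r i)))) → RichT G m := by
    intro r J1 J2 J3 J4 hr j1 j2 j3 j4 hcase
    have hr2 : ∀ i, i < m + 1 → r i < 2 * k := by
      intro i hi
      have := hr i hi
      have := hb i hi
      omega
    have hrm : ∀ i j, i < j → j < m + 1 → r i < r j := by
      intro i j hij hj
      have := hr i (by omega)
      have := hr j hj
      have := hg i j hij hj
      omega
    have X : ∀ i j, i < j → j < m + 1 → x' (r i) < x' (r j) :=
      fun i j hij hj => hxm _ _ (hrm i j hij hj) (hr2 j hj)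
    have Y : ∀ i j, i < j → j < m + 1 → (d ∧ y' (r i) < y' (r j)) ∨ (¬ d ∧ y' (r j) < y' (r i)) :=
      fun i j hij hj => hym _ _ (hrm i j hij hj) (hr2 j hj)
    have Y' : ∀ i j, i < j → j < m + 1 → y' (r i) ≠ y' (r j) := by
      intro i j hij hj
      rcases Y i j hij hj with h | h
      · exact h.2.ne
      · exact h.2.ne'
    have XY : ∀ i j, i < m + 1 → j < m + 1 → x' (r i) < y' (r j) :=
      fun i j hi hj => hxy' _ _ (hr2 i hi) (hr2 j hj)
    by_cases hpos : (J2 ∧ ¬ J3) ∨ (¬ J2 ∧ ¬ J3 ∧ ∀ i, i < m + 1 → G.Adj (x' (r i)) (y' (r i)))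
    · exact rich_hom G J1 J2 J3 J4 d (fun i => x' (r i)) (fun i => y' (r i)) X Y XY j1 j2 j3 j4 hpos
    · have hneg : (¬ J2 ∧ J3) ∨ (J2 ∧ J3 ∧ ∀ i, i < m + 1 → ¬ G.Adj (x' (r i)) (y' (r i))) := by
        tauto
      apply RichT.of_compl
      refine rich_hom Gᶜ (¬ J1) (¬ J2) (¬ J3) (¬ J4) d (fun i => x' (r i)) (fun i => y' (r i)) X Y XY
        ?_ ?_ ?_ ?_ ?_
      · intro i j hij hj
        rw [SimpleGraph.compl_adj, j1 i j hij hj]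
        exact and_iff_right (X i j hij hj).ne
      · intro i j hij hj
        rw [SimpleGraph.compl_adj, j2 i j hij hj]
        exact and_iff_right (XY i j (by omega) hj).ne
      · intro i j hij hj
        rw [SimpleGraph.compl_adj, j3 i j hij hj]
        exact and_iff_right (XY j i hj (by omega)).ne'
      · intro i j hij hj
        rw [SimpleGraph.compl_adj, j4 i j hij hj]
        exact and_iff_right (Y' i j hij hj)
      · rcases hneg with h | h
        · exact Or.inl ⟨h.1, not_not.2 h.2⟩
        · refine Or.inr ⟨not_not.2 h.1, not_not.2 h.2.1, fun i hi => ?_⟩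
          rw [SimpleGraph.compl_adj]
          exact ⟨(XY i i hi hi).ne, h.2.2 i hi⟩
  have dE : ∀ i, i < m + 1 → G.Adj (x' (e (g i))) (y' (e (g i))) :=
    fun i hi => (hef (g i) (hb i hi).2.2.2.2).2.2.2.2.1
  have dF : ∀ i, i < m + 1 → ¬ G.Adj (x' (f (g i))) (y' (f (g i))) :=
    fun i hi => (hef (g i) (hb i hi).2.2.2.2).2.2.2.2.2
  by_cases hE : col 1 ∧ col 2
  swap
  · refine gen (fun i => e (g i)) _ _ _ _ (fun i hi => ⟨(hb i hi).1, (hb i hi).2.1⟩) c0 c1 c2 c3 ?_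
    tauto
  by_cases hF : ¬ col 5 ∧ ¬ col 6
  swap
  · refine gen (fun i => f (g i)) _ _ _ _ (fun i hi => ⟨(hb i hi).2.2.1, (hb i hi).2.2.2.1⟩) c4 c5 c6 c7 ?_
    tauto
  by_cases h8 : col 8
  · -- fixed last `y`-vertex of type F
    refine rich_type1 G m (y' (f (g m))) (fun p => x' (e (g p))) (fun p => x' (f (g p))) ?_ ?_ ?_ ?_
    · intro i j hij hj
      have h1 := hb i (by omega)
      have h2 := hb j (by omega)
      have h3 := hg i j hij (by omega)
      refine ⟨hxm _ _ ?_ ?_, hxm _ _ ?_ ?_, hxm _ _ ?_ ?_, hxm _ _ ?_ ?_⟩ <;> omega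
    · refine Or.inr fun i hi => ?_
      have h1 := hb i (by omega)
      have h2 := hb m (by omega)
      constructor <;> apply hxy' <;> omega
    · intro i hi
      exact ((c8 i m hi (by omega)).2 h8).symm
    · intro i hi h
      exact hF.1 ((c5 i m hi (by omega)).1 h.symm)
  · -- fixed first `x`-vertex of type E
    have hYY : ∀ i j, i < j → j < 2 * k → d → y' i < y' j := by
      intro i j hij hj hd
      have := hym i j hij hj
      tauto
    have hYN : ∀ i j, i < j → j < 2 * k → ¬ d → y' j < y' i := by
      intro i j hij hj hd
      have := hym i j hij hj
      tauto
    by_cases hd : d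
    · refine rich_type1 G m (x' (e (g 0))) (fun p => y' (e (g (p + 1)))) (fun p => y' (f (g (p + 1)))) ?_ ?_ ?_ ?_
      · intro i j hij hj
        have h1 := hb (i + 1) (by omega)
        have h2 := hb (j + 1) (by omega)
        have h3 := hg (i + 1) (j + 1) (by omega) (by omega)
        refine ⟨hYY _ _ ?_ ?_ hd, hYY _ _ ?_ ?_ hd, hYY _ _ ?_ ?_ hd, hYY _ _ ?_ ?_ hd⟩ <;> omega
      · refine Or.inl fun i hi => ?_
        have h1 := hb (i + 1) (by omega)
        have h2 := hb 0 (by omega)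
        constructor <;> apply hxy' <;> omega
      · intro i hi
        exact (c1 0 (i + 1) (by omega) (by omega)).2 hE.1
      · intro i hi h
        exact h8 ((c8 0 (i + 1) (by omega) (by omega)).1 h)
    · refine rich_type1 G m (x' (e (g 0))) (fun p => y' (e (g (m - p)))) (fun p => y' (f (g (m - p)))) ?_ ?_ ?_ ?_
      · intro i j hij hj
        have h1 := hb (m - i) (by omega)
        have h2 := hb (m - j) (by omega)
        have h3 := hg (m - j) (m - i) (by omega) (by omega)
        refine ⟨hYN _ _ ?_ ?_ hd, hYN _ _ ?_ ?_ hd, hYN _ _ ?_ ?_ hd, hYN _ _ ?_ ?_ hd⟩ <;> omega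
      · refine Or.inl fun i hi => ?_
        have h1 := hb (m - i) (by omega)
        have h2 := hb 0 (by omega)
        constructor <;> apply hxy' <;> omega
      · intro i hi
        exact (c1 0 (m - i) (by omega) (by omega)).2 hE.1
      · intro i hi h
        exact h8 ((c8 0 (m - i) (by omega) (by omega)).1 h)

/-- **Lemma (Types 1 and 2 force speed `2^{n-1}`).**  If `P` contains `k`-structures of
Type 1 or Type 2 for arbitrarily large `k`, then `|P_n| ≥ 2^{n-1}` for every `n`. -/
theorem type12_speed (P : HerProp)
    (h : ∀ K : ℕ, ∃ k : ℕ, K ≤ k ∧ ∃ (N : ℕ) (G : SimpleGraph (Fin N)),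
        G ∈ P.mem N ∧ (HasType1 G k ∨ HasType2 G k)) :
    ∀ n : ℕ, 2 ^ (n - 1) ≤ speed P n := by
  classical
  intro n
  rcases n with _ | m
  · obtain ⟨k, -, N, G, hG, -⟩ := h 0
    have hmem : (⊥ : SimpleGraph (Fin 0)) ∈ P.mem 0 :=
      P.hered _ G ⟨(Fin.castLEOrderEmb (Nat.zero_le N)), fun i => i.elim0⟩ hG
    have : 0 < (P.mem 0).ncard := (Set.ncard_pos (Set.toFinite _)).2 ⟨_, hmem⟩
    simpa [speed, Nat.one_le_iff_ne_zero, Nat.pos_iff_ne_zero] using this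
  · obtain ⟨K, hK⟩ := rich_of_type2 m
    obtain ⟨k, hk, N, G, hG, hT⟩ := h (K + m + 1)
    have hR : RichT G m := by
      rcases hT with hT | hT
      · exact rich_of_type1 G (by omega) hT
      · exact hK k N G (by omega) hT
    obtain ⟨φ, hφ⟩ := hR
    have hsub : Set.range (fun s => G.comap (φ s)) ⊆ P.mem (m + 1) := by
      rintro _ ⟨s, rfl⟩
      exact P.hered _ G ⟨φ s, fun i j => Iff.rfl⟩ hG
    have hle := Set.ncard_le_ncard hsub (Set.toFinite _)
    rw [← Set.image_univ, Set.ncard_image_of_injective _ hφ, Set.ncard_univ,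
      Nat.card_eq_fintype_card] at hle
    simpa [speed] using hle
end

section
/- Let P be a hereditary property of ordered graphs and suppose that |P_n| < F_{n,ℓ+1} for some ℓ, n ∈ ℕ. Then there exists K ∈ ℕ such that the vertex set of every ordered graph G ∈ P may be partitioned into at most K blocks of consecutive vertices, with each block ℓ-homogeneous. -/
open Finset

/-- Adjacency of `G` transported to natural numbers. -/
def AN {N : ℕ} (G : SimpleGraph (Fin N)) (a b : ℕ) : Prop :=
  ∃ (ha : a < N) (hb : b < N), G.Adj ⟨a, ha⟩ ⟨b, hb⟩

lemma AN_symm {N : ℕ} (G : SimpleGraph (Fin N)) (a b : ℕ) : AN G a b ↔ AN G b a := by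
  constructor
  · rintro ⟨h, h', h''⟩; exact ⟨h', h, h''.symm⟩
  · rintro ⟨h, h', h''⟩; exact ⟨h', h, h''.symm⟩

lemma AN_iff {N : ℕ} (G : SimpleGraph (Fin N)) (a b : Fin N) : AN G a b ↔ G.Adj a b := by
  constructor
  · rintro ⟨h, h', h''⟩; exact h''
  · intro h; exact ⟨a.2, b.2, h⟩

/-- Counting lemma. -/
lemma count_general (P : HerProp) {N n : ℕ} (G : SimpleGraph (Fin N)) (hG : G ∈ P.mem N)
    {ι : Type} [Fintype ι] (v : ι → Fin n → ℕ) (hN : ∀ w p, v w p < N)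
    (hinj : ∀ w, Function.Injective (v w))
    (hs : ∀ (w w' : ι) (σ : Equiv.Perm (Fin n)),
      (∀ p q, v w p < v w q ↔ v w' (σ p) < v w' (σ q)) →
      (∀ p q, AN G (v w p) (v w q) ↔ AN G (v w' (σ p)) (v w' (σ q))) → w = w') :
    Fintype.card ι ≤ speed P n := by
  classical
  have hmono : ∀ w, StrictMono (v w ∘ Tuple.sort (v w)) := fun w =>
    (Tuple.monotone_sort (v w)).strictMono_of_injective
      ((hinj w).comp (Tuple.sort (v w)).injective)
  let φ : ι → Fin n → Fin N := fun w p => ⟨v w (Tuple.sort (v w) p), hN _ _⟩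
  have hφ : ∀ w, StrictMono (φ w) := fun w p q h => hmono w h
  let H : ι → SimpleGraph (Fin n) := fun w => G.comap (φ w)
  have hH : ∀ w, H w ∈ P.mem n := fun w =>
    P.hered (H w) G ⟨OrderEmbedding.ofStrictMono (φ w) (hφ w), fun i j => Iff.rfl⟩ hG
  have hHinj : Function.Injective H := by
    intro w w' e
    refine hs w w' ((Tuple.sort (v w)).symm.trans (Tuple.sort (v w'))) ?_ ?_
    · intro p q
      have h1 := (hmono w).lt_iff_lt (a := (Tuple.sort (v w)).symm p)
        (b := (Tuple.sort (v w)).symm q)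
      have h2 := (hmono w').lt_iff_lt (a := (Tuple.sort (v w)).symm p)
        (b := (Tuple.sort (v w)).symm q)
      simp only [Function.comp, Equiv.apply_symm_apply] at h1 h2
      simp only [Equiv.trans_apply]
      rw [h1, h2]
    · intro p q
      have h1 : (H w).Adj ((Tuple.sort (v w)).symm p) ((Tuple.sort (v w)).symm q) ↔
        (H w').Adj ((Tuple.sort (v w)).symm p) ((Tuple.sort (v w)).symm q) := by rw [e]
      simp only [H, SimpleGraph.comap_adj] at h1
      rw [← AN_iff, ← AN_iff] at h1
      simpa [φ] using h1
  unfold speed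
  rw [← Nat.card_eq_fintype_card, ← Set.ncard_univ, ← Set.ncard_image_of_injective _ hHinj]
  apply Set.ncard_le_ncard _ (Set.toFinite _)
  rintro _ ⟨w, -, rfl⟩
  exact hH w

lemma count_mono (P : HerProp) {N n : ℕ} (G : SimpleGraph (Fin N)) (hG : G ∈ P.mem N)
    {ι : Type} [Fintype ι] (v : ι → Fin n → ℕ) (hN : ∀ w p, v w p < N)
    (hinj : ∀ w, StrictMono (v w))
    (hs : ∀ (w w' : ι),
      (∀ p q, AN G (v w p) (v w q) ↔ AN G (v w' p) (v w' q)) → w = w') :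
    Fintype.card ι ≤ speed P n := by
  refine count_general P G hG v hN (fun w => (hinj w).injective) ?_
  intro w w' σ h1 h2
  apply hs
  have hσ : StrictMono σ := by
    intro p q hpq
    exact (hinj w').lt_iff_lt.1 ((h1 p q).1 (hinj w hpq))
  have : ∀ p, σ p = p := by
    intro p
    have e := Subsingleton.elim (StrictMono.orderIsoOfSurjective σ hσ σ.surjective) (OrderIso.refl _)
    have := congrArg (fun f : Fin n ≃o Fin n => f p) e
    simpa using this
  simpa [this] using h2

/-- Type 1 structures give all patterns. -/
lemma type1 (P : HerProp) {N m : ℕ} (G : SimpleGraph (Fin N)) (hG : G ∈ P.mem N)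
    (u : ℕ) (s : Bool → ℕ → ℕ) (hu : u < N) (hN : ∀ b, ∀ i < m, s b i < N)
    (hs : ∀ b b' i j, i < j → j < m → s b i < s b' j)
    (hside : (∀ b, ∀ i < m, u < s b i) ∨ (∀ b, ∀ i < m, s b i < u))
    (hA : ∀ i < m, ¬ (AN G u (s true i) ↔ AN G u (s false i))) :
    2 ^ m ≤ speed P (m + 1) := by
  have key : ∀ i < m, ∀ b b', (AN G u (s b i) ↔ AN G u (s b' i)) → b = b' := by
    intro i hi b b' h
    have := hA i hi
    cases b <;> cases b' <;> simp_all
  rcases hside with h | h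
  · have := count_mono P (n := m + 1) G hG (ι := Fin m → Bool)
      (fun w => Fin.cons u (fun i => s (w i) i)) ?_ ?_ ?_
    · simpa using this
    · intro w p
      refine Fin.cases ?_ (fun i => ?_) p
      · simpa using hu
      · simpa using hN _ _ i.2
    · intro w p q
      refine Fin.cases ?_ (fun i => ?_) p <;> refine Fin.cases ?_ (fun j => ?_) q
      · simp
      · intro _; simpa using h _ _ j.2
      · simp
      · intro hh; simpa using hs _ _ _ _ (by simpa using hh) j.2
    · intro w w' hh
      funext i
      have := hh 0 i.succ
      simp only [Fin.cons_zero, Fin.cons_succ] at this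
      exact key i i.2 _ _ this
  · have := count_mono P (n := m + 1) G hG (ι := Fin m → Bool)
      (fun w => Fin.snoc (α := fun _ => ℕ) (fun i => s (w i) i) u) ?_ ?_ ?_
    · simpa using this
    · intro w p
      refine Fin.lastCases ?_ (fun i => ?_) p
      · simpa using hu
      · simpa using hN _ _ i.2
    · intro w p q
      refine Fin.lastCases ?_ (fun i => ?_) p <;> refine Fin.lastCases ?_ (fun j => ?_) q
      · simp
      · intro hh; exact absurd hh (by simpa using (Fin.le_last _))
      · intro _; simpa using h _ _ i.2
      · intro hh; simpa using hs _ _ _ _ (by simpa using hh) j.2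
    · intro w w' hh
      funext i
      have := hh (Fin.last m) i.castSucc
      simp only [Fin.snoc_last, Fin.snoc_castSucc] at this
      exact key i i.2 _ _ this

lemma genFib_succ (k n : ℕ) : genFib k (n + 1) =
    ∑ i ∈ Finset.range k, if i ≤ n then genFib k (n - i) else 0 := by
  rw [genFib]

lemma genFib_succ_le (k n : ℕ) : genFib k (n + 1) ≤ ∑ j ∈ Finset.range (n + 1), genFib k j := by
  rw [genFib_succ, ← Finset.sum_filter, ← Finset.sum_range_reflect]
  have : ∀ j ∈ Finset.range (n + 1), genFib k (n + 1 - 1 - j) = genFib k (n - j) := by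
    intro j _; simp
  rw [Finset.sum_congr rfl this]
  apply Finset.sum_le_sum_of_subset
  intro i hi
  simp at hi ⊢
  omega

lemma genFib_sum_le (k n : ℕ) : ∑ j ∈ Finset.range (n + 1), genFib k j ≤ 2 ^ n := by
  induction n with
  | zero => simp [genFib]
  | succ n ih =>
    rw [Finset.sum_range_succ, pow_succ]
    have := genFib_succ_le k n
    omega

lemma genFib_le (k m : ℕ) : genFib k (m + 1) ≤ 2 ^ m :=
  (genFib_succ_le k m).trans (genFib_sum_le k m)

/-- Finite Ramsey theorem for pairs. -/
lemma ramsey_aux (κ : Type) [Finite κ] (m : ℕ) : ∃ M : ℕ, ∀ (f : ℕ → ℕ → κ) (S : Finset ℕ),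
    M ≤ S.card → ∃ (g : ℕ → ℕ) (k : ℕ → κ), (∀ i < m, g i ∈ S) ∧
      ∀ i j, i < j → j < m → g i < g j ∧ f (g i) (g j) = k i := by
  classical
  have := Fintype.ofFinite κ
  induction m with
  | zero => exact ⟨0, fun f S _ => ⟨id, fun _ => f 0 0, by simp, by simp⟩⟩
  | succ m ih =>
    obtain ⟨M, hM⟩ := ih
    refine ⟨Fintype.card κ * M + 1, fun f S hS => ?_⟩
    have hne : S.Nonempty := by
      rw [← Finset.card_pos]; omega
    set a := S.min' hne with ha
    have hcard : (S.erase a).card = S.card - 1 := Finset.card_erase_of_mem (S.min'_mem hne)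
    have : Nonempty κ := ⟨f 0 0⟩
    obtain ⟨y, -, hy⟩ := Finset.exists_le_card_fiber_of_mul_le_card_of_maps_to
      (s := S.erase a) (t := (Finset.univ : Finset κ)) (f := fun b => f a b) (n := M)
      (by simp) (by simp) (by rw [hcard, Finset.card_univ]; omega)
    obtain ⟨g, k, h1, h2⟩ := hM f _ hy
    refine ⟨fun i => Nat.casesOn i a g, fun i => Nat.casesOn i y k, ?_, ?_⟩
    · rintro (_ | i) hi
      · exact S.min'_mem hne
      · have := h1 i (by omega)
        simp only [Finset.mem_filter, Finset.mem_erase] at this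
        exact this.1.2
    · rintro (_ | i) (_ | j) hij hj
      · omega
      · have := h1 j (by omega)
        simp only [Finset.mem_filter, Finset.mem_erase] at this
        refine ⟨?_, this.2⟩
        exact lt_of_le_of_ne (S.min'_le _ this.1.2) (Ne.symm this.1.1)
      · omega
      · exact h2 i j (by omega) (by omega)

lemma ramsey (κ : Type) [Finite κ] (m : ℕ) : ∃ M : ℕ, ∀ (f : ℕ → ℕ → κ),
    ∃ (g : ℕ → ℕ) (k : κ), (∀ i < m, g i < M) ∧
      ∀ i j, i < j → j < m → g i < g j ∧ f (g i) (g j) = k := by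
  classical
  have := Fintype.ofFinite κ
  obtain ⟨M, hM⟩ := ramsey_aux κ (Fintype.card κ * m)
  refine ⟨M, fun f => ?_⟩
  obtain ⟨g, k, h1, h2⟩ := hM f (Finset.range M) (by simp)
  have : Nonempty κ := ⟨f 0 0⟩
  obtain ⟨y, -, hy⟩ := Finset.exists_le_card_fiber_of_mul_le_card_of_maps_to
      (s := Finset.range (Fintype.card κ * m)) (t := (Finset.univ : Finset κ)) (f := k) (n := m)
      (by simp) (by simp) (by simp)
  obtain ⟨S, hS, hSm⟩ := Finset.exists_subset_card_eq hy
  have hmem : ∀ i (hi : i < m), S.orderEmbOfFin hSm ⟨i, hi⟩ < Fintype.card κ * m ∧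
      k (S.orderEmbOfFin hSm ⟨i, hi⟩) = y := by
    intro i hi
    have := hS (S.orderEmbOfFin_mem hSm ⟨i, hi⟩)
    simpa using this
  refine ⟨fun i => if hi : i < m then g (S.orderEmbOfFin hSm ⟨i, hi⟩) else 0, y, ?_, ?_⟩
  · intro i hi
    simp only [hi, dif_pos]
    simpa using h1 _ (hmem i hi).1
  · intro i j hij hj
    have hi : i < m := by omega
    simp only [hi, hj, dif_pos]
    have hlt : S.orderEmbOfFin hSm ⟨i, hi⟩ < S.orderEmbOfFin hSm ⟨j, hj⟩ :=
      (S.orderEmbOfFin hSm).strictMono hij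
    have := h2 _ _ hlt (hmem j hj).1
    exact ⟨this.1, this.2.trans (hmem i hi).2⟩

/-- The vertex chosen by a word at position `p`. -/
def wv {n : ℕ} (x y : ℕ → ℕ) (w : Fin n → Bool) (p : Fin n) : ℕ :=
  if w p = true then x p else y p

/-- Two words give the same ordered graph via `σ`. -/
def WRel {n : ℕ} (A : ℕ → ℕ → Prop) (x y : ℕ → ℕ) (w w' : Fin n → Bool)
    (σ : Equiv.Perm (Fin n)) : Prop :=
  (∀ p q, wv x y w p < wv x y w q ↔ wv x y w' (σ p) < wv x y w' (σ q)) ∧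
  (∀ p q, A (wv x y w p) (wv x y w q) ↔ A (wv x y w' (σ p)) (wv x y w' (σ q)))

lemma WRel.symm' {n : ℕ} {A : ℕ → ℕ → Prop} {x y : ℕ → ℕ} {w w' : Fin n → Bool}
    {σ : Equiv.Perm (Fin n)} (h : WRel A x y w w' σ) : WRel A x y w' w σ.symm := by
  constructor
  · intro p q
    simpa using (h.1 (σ.symm p) (σ.symm q)).symm
  · intro p q
    simpa using (h.2 (σ.symm p) (σ.symm q)).symm

/-- Hypotheses on the sequences for the type 2 counting. -/
structure T2 (A : ℕ → ℕ → Prop) (n : ℕ) (x y : ℕ → ℕ) (I1 I4 c : Prop) : Prop where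
  symm : ∀ a b, A a b ↔ A b a
  ord : ((∀ i j, i < j → j < n → x i < x j) ∧ (∀ i j, i < n → j < n → x i < y j)) ∨
    ((∀ i j, i < j → j < n → x j < x i) ∧ (∀ i j, i < n → j < n → y j < x i))
  ordy : (∀ i j, i < j → j < n → y i < y j) ∨ (∀ i j, i < j → j < n → y j < y i)
  hxx : ∀ i j, i < j → j < n → (A (x i) (x j) ↔ I1)
  hyy : ∀ i j, i < j → j < n → (A (y i) (y j) ↔ I4)
  hnext : ∀ i, i + 1 < n → (A (x i) (y (i + 1)) ↔ ¬ c)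
  hback : ∀ i j, j < i → i < n → (A (x i) (y j) ↔ c)

section

variable {n : ℕ} {A : ℕ → ℕ → Prop} {x y : ℕ → ℕ} {I1 I4 c : Prop}

lemma T2.hxx' (t : T2 A n x y I1 I4 c) {i j : ℕ} (hij : i ≠ j) (hi : i < n) (hj : j < n) :
    A (x i) (x j) ↔ I1 := by
  rcases lt_or_gt_of_ne hij with h | h
  · exact t.hxx i j h hj
  · rw [t.symm]; exact t.hxx j i h hi

lemma T2.hyy' (t : T2 A n x y I1 I4 c) {i j : ℕ} (hij : i ≠ j) (hi : i < n) (hj : j < n) :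
    A (y i) (y j) ↔ I4 := by
  rcases lt_or_gt_of_ne hij with h | h
  · exact t.hyy i j h hj
  · rw [t.symm]; exact t.hyy j i h hi

lemma T2.inj (t : T2 A n x y I1 I4 c) (w : Fin n → Bool) : Function.Injective (wv x y w) := by
  have aux : ∀ p q : Fin n, p < q → wv x y w p ≠ wv x y w q := by
    intro p q hpq
    have h0 : (p : ℕ) < q := hpq
    unfold wv
    have h1 := t.ord
    have h2 := t.ordy
    split_ifs
    · rcases h1 with h | h
      · exact (h.1 _ _ h0 q.2).ne
      · exact (h.1 _ _ h0 q.2).ne'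
    · rcases h1 with h | h
      · exact (h.2 _ _ p.2 q.2).ne
      · exact (h.2 _ _ p.2 q.2).ne'
    · rcases h1 with h | h
      · exact (h.2 _ _ q.2 p.2).ne'
      · exact (h.2 _ _ q.2 p.2).ne
    · rcases h2 with h | h
      · exact (h _ _ h0 q.2).ne
      · exact (h _ _ h0 q.2).ne'
  intro p q hpq
  by_contra hne
  rcases lt_or_gt_of_ne hne with h | h
  · exact aux _ _ h hpq
  · exact aux _ _ h hpq.symm

lemma seq_dir {x : ℕ → ℕ} (h : (∀ i j, i < j → j < n → x i < x j) ∨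
    (∀ i j, i < j → j < n → x j < x i)) {p q r s : Fin n}
    (hh : x p < x q ↔ x r < x s) (hpq : p ≠ q) (hrs : r ≠ s) : p < q ↔ r < s := by
  have h1 : (p : ℕ) < q ∨ (q : ℕ) < p := lt_or_gt_of_ne (Fin.val_ne_of_ne hpq)
  have h2 : (r : ℕ) < s ∨ (s : ℕ) < r := lt_or_gt_of_ne (Fin.val_ne_of_ne hrs)
  rw [Fin.lt_def, Fin.lt_def]
  have := p.2
  have := q.2
  have := r.2
  have := s.2
  rcases h with h | h
  · have a1 := h p q
    have a2 := h q p
    have a3 := h r s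
    have a4 := h s r
    omega
  · have a1 := h p q
    have a2 := h q p
    have a3 := h r s
    have a4 := h s r
    omega

lemma T2.mono (t : T2 A n x y I1 I4 c) {w w' : Fin n → Bool} {σ : Equiv.Perm (Fin n)}
    (h : WRel A x y w w' σ) (hl : ∀ p, w' (σ p) = w p) {p q : Fin n} (hpq : w p = w q) :
    p < q ↔ σ p < σ q := by
  by_cases hne : p = q
  · subst hne; simp
  have hne' : σ p ≠ σ q := fun e => hne (σ.injective e)
  have h1 := h.1 p q
  unfold wv at h1
  rw [hl, hl] at h1
  cases hp : w p
  · have hq : w q = false := by rw [← hpq, hp]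
    simp only [hp, hq, Bool.false_eq_true, if_false] at h1
    exact seq_dir t.ordy h1 hne hne'
  · have hq : w q = true := by rw [← hpq, hp]
    simp only [hp, hq, if_true] at h1
    refine seq_dir ?_ h1 hne hne'
    rcases t.ord with h | h
    · exact Or.inl h.1
    · exact Or.inr h.1

/-- key step for determining the words. -/
lemma T2.step (t : T2 A n x y I1 I4 c) {w w' : Fin n → Bool} {σ : Equiv.Perm (Fin n)}
    (h : WRel A x y w w' σ) (hl : ∀ p, w' (σ p) = w p) (p : Fin n)
    (hlt : ∀ r < p, σ r = r) (h1 : w p = true) (h2 : w' p = false) : False := by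
  obtain ⟨q, hq⟩ := σ.surjective p
  have hge : ∀ r, p ≤ r → p ≤ σ r := by
    intro r hr
    by_contra hc
    have h3 := hlt _ (not_le.1 hc)
    have h4 := σ.injective h3
    rw [h4] at hc
    exact hc hr
  have hwq : w q = false := by rw [← hl, hq, h2]
  have hpq : p < q := by
    rcases lt_trichotomy p q with h' | h' | h'
    · exact h'
    · subst h'; rw [h1] at hwq; simp at hwq
    · have := hlt q h'
      rw [hq] at this
      exact absurd this h'.ne'
  have hq0 : (p : ℕ) < q := hpq
  let r : Fin n := ⟨q - 1, by omega⟩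
  have hrq : r < q := by rw [Fin.lt_def]; simp only [r]; omega
  have hpr : p ≤ r := by rw [Fin.le_def]; simp only [r]; omega
  have hwr : w r = true := by
    by_contra hc
    have hc : w r = false := by simpa using hc
    have h3 := (t.mono h hl (p := r) (q := q) (by rw [hc, hwq])).1 hrq
    rw [hq] at h3
    exact absurd (hge r hpr) (not_le.2 h3)
  have h4 := h.2 r q
  have hσr : w' (σ r) = true := by rw [hl, hwr]
  have hpσ : p < σ r := lt_of_le_of_ne (hge r hpr) (by
    intro e; rw [← e, h2] at hσr; simp at hσr)
  unfold wv at h4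
  rw [hl, hl, hq] at h4
  simp only [hwr, hwq, if_true, Bool.false_eq_true, if_false] at h4
  rw [t.hback _ _ hpσ (σ r).2] at h4
  have h5 := t.hnext r (by simp only [r]; omega)
  have h6 : (r : ℕ) + 1 = q := by simp only [r]; omega
  rw [h6] at h5
  tauto

lemma T2.word_eq (t : T2 A n x y I1 I4 c) {w w' : Fin n → Bool} {σ : Equiv.Perm (Fin n)}
    (h : WRel A x y w w' σ) (hl : ∀ p, w' (σ p) = w p) : w = w' := by
  have hl' : ∀ p, w (σ.symm p) = w' p := by
    intro p; rw [← hl]; simp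
  have main : ∀ k : ℕ, ∀ hk : k < n, w ⟨k, hk⟩ = w' ⟨k, hk⟩ ∧ σ ⟨k, hk⟩ = ⟨k, hk⟩ := by
    intro k
    induction k using Nat.strong_induction_on with
    | _ k ih =>
      intro hk
      have hlt : ∀ r < (⟨k, hk⟩ : Fin n), σ r = r := fun r hr => (ih r hr r.2).2
      have hlt' : ∀ r < (⟨k, hk⟩ : Fin n), σ.symm r = r := fun r hr => by
        rw [Equiv.symm_apply_eq, hlt r hr]
      have hw : w ⟨k, hk⟩ = w' ⟨k, hk⟩ := by
        cases h1 : w ⟨k, hk⟩ <;> cases h2 : w' ⟨k, hk⟩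
        · rfl
        · exact (t.step h.symm' hl' _ hlt' h2 h1).elim
        · exact (t.step h hl _ hlt h1 h2).elim
        · rfl
      refine ⟨hw, ?_⟩
      by_contra hne
      obtain ⟨q, hq⟩ := σ.surjective ⟨k, hk⟩
      have hwq : w q = w ⟨k, hk⟩ := by rw [← hl, hq, hw]
      have hge : ∀ r, (⟨k, hk⟩ : Fin n) ≤ r → (⟨k, hk⟩ : Fin n) ≤ σ r := by
        intro r hr
        by_contra hc
        have h4 := σ.injective (hlt _ (not_le.1 hc))
        rw [h4] at hc
        exact hc hr
      have h1 : (⟨k, hk⟩ : Fin n) < q := by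
        rcases lt_trichotomy (⟨k, hk⟩ : Fin n) q with h' | h' | h'
        · exact h'
        · rw [← h'] at hq; exact absurd hq hne
        · have := hlt q h'
          rw [hq] at this
          exact absurd this h'.ne'
      have h2 := (t.mono h hl hwq.symm).1 h1
      rw [hq] at h2
      exact absurd (hge _ le_rfl) (not_le.2 h2)
  funext p
  exact (main p p.2).1

lemma T2.letters_aux {m : ℕ} (t : T2 A (m + 1) x y I1 I4 c) {w w' : Fin (m + 1) → Bool}
    {σ : Equiv.Perm (Fin (m + 1))} (h : WRel A x y w w' σ)
    (hw : (¬ (I1 ↔ c) ∧ w (Fin.last m) = true ∧ w' (Fin.last m) = true) ∨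
      (¬ (I4 ↔ c) ∧ w 0 = false ∧ w' 0 = false) ∨
      ((I1 ↔ c) ∧ (I4 ↔ c) ∧ w (Fin.last m) = false ∧ w' (Fin.last m) = false))
    (v : Fin (m + 1)) (h1 : w v = false) (h2 : w' (σ v) = true) : False := by
  have hno : ∀ p, w p = true → w' (σ p) = true := by
    intro p hp
    by_contra hc
    have hc : w' (σ p) = false := by simpa using hc
    have h3 := h.1 p v
    have h4 := h.1 v p
    unfold wv at h3 h4
    simp only [h1, h2, hp, hc, if_true, Bool.false_eq_true, if_false] at h3 h4
    rcases t.ord with ho | ho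
    · have := ho.2 p v p.2 v.2
      have := ho.2 (σ v) (σ p) (σ v).2 (σ p).2
      omega
    · have := ho.2 p v p.2 v.2
      have := ho.2 (σ v) (σ p) (σ v).2 (σ p).2
      omega
  have hno' : ∀ p, w' p = false → w (σ.symm p) = false := by
    intro p hp
    by_contra hc
    have := hno (σ.symm p) (by simpa using hc)
    simp [hp] at this
  rcases hw with ⟨hI, ha, hb⟩ | ⟨hI, ha, hb⟩ | ⟨hI, hI', ha, hb⟩
  · have hne : v ≠ Fin.last m := by rintro rfl; rw [h1] at ha; simp at ha
    have hlt : (v : ℕ) < Fin.last m := (Fin.lt_last_iff_ne_last.2 hne)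
    have h3 := h.2 (Fin.last m) v
    unfold wv at h3
    simp only [h1, h2, ha, hno _ ha, if_true, Bool.false_eq_true, if_false] at h3
    rw [t.hback _ _ hlt (Fin.last m).2, t.hxx' _ (σ _).2 (σ _).2] at h3
    · tauto
    · intro e
      exact hne (σ.injective (Fin.ext e)).symm
  · have h5 := hno' 0 hb
    have h3 := h.2 v (σ.symm 0)
    unfold wv at h3
    simp only [h1, h2, h5, hb, Equiv.apply_symm_apply, if_true, Bool.false_eq_true, if_false] at h3
    have hne : σ v ≠ 0 := by
      intro e; rw [e, hb] at h2; simp at h2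
    have hlt : ((0 : Fin (m + 1)) : ℕ) < σ v := Fin.pos_iff_ne_zero.2 hne
    rw [t.hback _ _ hlt (σ v).2, t.hyy' _ v.2 (σ.symm 0).2] at h3
    · tauto
    · intro e
      apply hne
      rw [Fin.ext e]; simp
  · have hne : (Finset.univ.filter (fun u => w' u = true)).Nonempty := ⟨σ v, by simp [h2]⟩
    set u := (Finset.univ.filter (fun u => w' u = true)).max' hne with hu
    have hwu : w' u = true := by
      have := Finset.max'_mem _ hne
      rw [← hu] at this
      simpa using this
    have hmax : ∀ r, w' r = true → r ≤ u := fun r hr => Finset.le_max' _ _ (by simp [hr])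
    have hul : u ≠ Fin.last m := by rintro e; rw [e, hb] at hwu; simp at hwu
    have hlt : (u : ℕ) < m := (Fin.lt_last_iff_ne_last.2 hul)
    let u1 : Fin (m + 1) := ⟨u + 1, by omega⟩
    have hwu1 : w' u1 = false := by
      by_contra hc
      have := hmax u1 (by simpa using hc)
      rw [Fin.le_def] at this
      simp only [u1] at this
      omega
    have h5 := hno' u1 hwu1
    have h6 : w (σ.symm u) = false := by
      by_contra hc
      have hc : w (σ.symm u) = true := by simpa using hc
      have hle := hmax _ h2
      have hne' : σ v ≠ u := by
        intro e
        rw [← e] at hc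
        simp [h1] at hc
      have hlt' : (σ v : ℕ) < u := lt_of_le_of_ne hle (Fin.val_ne_of_ne hne')
      have h3 := h.1 (σ.symm u) v
      have h4 := h.1 v (σ.symm u)
      unfold wv at h3 h4
      simp only [h1, h2, hc, hwu, Equiv.apply_symm_apply, if_true, Bool.false_eq_true,
        if_false] at h3 h4
      rcases t.ord with ho | ho
      · have := ho.2 (σ.symm u) v (σ.symm u).2 v.2
        have := ho.1 _ _ hlt' u.2
        omega
      · have := ho.2 (σ.symm u) v (σ.symm u).2 v.2
        have := ho.1 _ _ hlt' u.2
        omega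
    have h3 := h.2 (σ.symm u) (σ.symm u1)
    unfold wv at h3
    simp only [h5, h6, hwu, hwu1, Equiv.apply_symm_apply, if_true, Bool.false_eq_true,
        if_false] at h3
    have h7 := t.hnext u (by omega)
    have h8 : A (x u) (y u1) ↔ ¬ c := h7
    rw [h8, t.hyy' _ (σ.symm u).2 (σ.symm u1).2] at h3
    · tauto
    · intro e
      have := σ.symm.injective (Fin.ext e)
      have := congrArg Fin.val this
      simp [u1] at this

lemma T2.count (P : HerProp) {N m : ℕ} (G : SimpleGraph (Fin N)) (hG : G ∈ P.mem N)
    (t : T2 (AN G) (m + 1) x y I1 I4 c) (hx : ∀ i < m + 1, x i < N) (hy : ∀ i < m + 1, y i < N) :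
    2 ^ m ≤ speed P (m + 1) := by
  classical
  have hN : ∀ (w : Fin (m + 1) → Bool) p, wv x y w p < N := by
    intro w p
    unfold wv
    split_ifs
    · exact hx p p.2
    · exact hy p p.2
  have gen : ∀ E : (Fin m → Bool) → (Fin (m + 1) → Bool), Function.Injective E →
      (∀ a b, (¬ (I1 ↔ c) ∧ E a (Fin.last m) = true ∧ E b (Fin.last m) = true) ∨
      (¬ (I4 ↔ c) ∧ E a 0 = false ∧ E b 0 = false) ∨
      ((I1 ↔ c) ∧ (I4 ↔ c) ∧ E a (Fin.last m) = false ∧ E b (Fin.last m) = false)) →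
      2 ^ m ≤ speed P (m + 1) := by
    intro E hE hcond
    have := count_general P (n := m + 1) G hG (ι := Fin m → Bool)
      (fun a => wv x y (E a)) (fun a p => hN _ p) (fun a => t.inj _) ?_
    · simpa using this
    · intro a b σ g1 g2
      have hr : WRel (AN G) x y (E a) (E b) σ := ⟨g1, g2⟩
      apply hE
      refine t.word_eq hr ?_
      intro p
      cases e1 : E b (σ p) <;> cases e2 : E a p
      · rfl
      · exact (t.letters_aux hr.symm' (hcond b a) (σ p) e1 (by simpa using e2)).elim
      · exact (t.letters_aux hr (hcond a b) p e2 e1).elim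
      · rfl
  by_cases hI1 : I1 ↔ c
  · by_cases hI4 : I4 ↔ c
    · refine gen (fun a => Fin.snoc (α := fun _ => Bool) a false) ?_ ?_
      · intro a b hab
        funext i
        have := congrFun hab i.castSucc
        simpa using this
      · intro a b
        simp [hI1, hI4]
    · refine gen (fun a => Fin.cons (α := fun _ => Bool) false a) ?_ ?_
      · intro a b hab
        funext i
        have := congrFun hab i.succ
        simpa using this
      · intro a b
        simp [hI4]
  · refine gen (fun a => Fin.snoc (α := fun _ => Bool) a true) ?_ ?_
    · intro a b hab
      funext i
      have := congrFun hab i.castSucc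
      simpa using this
    · intro a b
      simp [hI1]

/-- Type 2 structures from homogeneous sequences. -/
lemma type2 (P : HerProp) {N m : ℕ} (G : SimpleGraph (Fin N)) (hG : G ∈ P.mem N)
    (a b : ℕ → ℕ) (J1 J4 J0 J2 J3 : Prop)
    (ha : ∀ i < m + 2, a i < N) (hb : ∀ i < m + 2, b i < N)
    (hside : (∀ i j, i < m + 2 → j < m + 2 → a i < b j) ∨
      (∀ i j, i < m + 2 → j < m + 2 → b j < a i))
    (hoa : ∀ i j, i < j → j < m + 2 → a i < a j)
    (hob : (∀ i j, i < j → j < m + 2 → b i < b j) ∨ (∀ i j, i < j → j < m + 2 → b j < b i))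
    (h1 : ∀ i j, i < j → j < m + 2 → (AN G (a i) (a j) ↔ J1))
    (h4 : ∀ i j, i < j → j < m + 2 → (AN G (b i) (b j) ↔ J4))
    (h2 : ∀ i j, i < j → j < m + 2 → (AN G (a i) (b j) ↔ J2))
    (h3 : ∀ i j, i < j → j < m + 2 → (AN G (a j) (b i) ↔ J3))
    (h0 : ∀ i < m + 2, (AN G (a i) (b i) ↔ J0))
    (hne : ¬ ((J2 ↔ J3) ∧ (J0 ↔ J3))) : 2 ^ m ≤ speed P (m + 1) := by
  rcases hside with hs | hs
  · by_cases hc : J2 ↔ J3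
    · have hc' : ¬ (J0 ↔ J3) := fun e => hne ⟨hc, e⟩
      refine T2.count P G hG (x := fun i => a (i + 1)) (y := b) (I1 := J1) (I4 := J4) (c := J3)
        ⟨AN_symm G, Or.inl ⟨?_, ?_⟩, ?_, ?_, ?_, ?_, ?_⟩ ?_ ?_
      · intro i j hij hj; exact hoa _ _ (by omega) (by omega)
      · intro i j hij hj; exact hs _ _ (by omega) (by omega)
      · rcases hob with h | h
        · left; intro i j hij hj; exact h _ _ (by omega) (by omega)
        · right; intro i j hij hj; exact h _ _ (by omega) (by omega)
      · intro i j hij hj; exact h1 _ _ (by omega) (by omega)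
      · intro i j hij hj; exact h4 _ _ (by omega) (by omega)
      · intro i hi; rw [h0 _ (by omega)]; tauto
      · intro i j hij hj; exact h3 _ _ (by omega) (by omega)
      · intro i hi; exact ha _ (by omega)
      · intro i hi; exact hb _ (by omega)
    · refine T2.count P G hG (x := a) (y := b) (I1 := J1) (I4 := J4) (c := J3)
        ⟨AN_symm G, Or.inl ⟨?_, ?_⟩, ?_, ?_, ?_, ?_, ?_⟩ ?_ ?_
      · intro i j hij hj; exact hoa _ _ (by omega) (by omega)
      · intro i j hij hj; exact hs _ _ (by omega) (by omega)
      · rcases hob with h | h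
        · left; intro i j hij hj; exact h _ _ (by omega) (by omega)
        · right; intro i j hij hj; exact h _ _ (by omega) (by omega)
      · intro i j hij hj; exact h1 _ _ (by omega) (by omega)
      · intro i j hij hj; exact h4 _ _ (by omega) (by omega)
      · intro i hi; rw [h2 _ _ (by omega) (by omega)]; tauto
      · intro i j hij hj; exact h3 _ _ (by omega) (by omega)
      · intro i hi; exact ha _ (by omega)
      · intro i hi; exact hb _ (by omega)
  · by_cases hc : J2 ↔ J3
    · have hc' : ¬ (J0 ↔ J2) := fun e => hne ⟨hc, e.trans hc⟩
      refine T2.count P G hG (x := fun i => a (m + 1 - (i + 1))) (y := fun i => b (m + 1 - i))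
        (I1 := J1) (I4 := J4) (c := J2)
        ⟨AN_symm G, Or.inr ⟨?_, ?_⟩, ?_, ?_, ?_, ?_, ?_⟩ ?_ ?_
      · intro i j hij hj; exact hoa _ _ (by omega) (by omega)
      · intro i j hij hj; exact hs _ _ (by omega) (by omega)
      · rcases hob with h | h
        · right; intro i j hij hj; exact h _ _ (by omega) (by omega)
        · left; intro i j hij hj; exact h _ _ (by omega) (by omega)
      · intro i j hij hj; rw [AN_symm]; exact h1 _ _ (by omega) (by omega)
      · intro i j hij hj; rw [AN_symm]; exact h4 _ _ (by omega) (by omega)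
      · intro i hi; rw [h0 _ (by omega)]; tauto
      · intro i j hij hj; exact h2 _ _ (by omega) (by omega)
      · intro i hi; exact ha _ (by omega)
      · intro i hi; exact hb _ (by omega)
    · refine T2.count P G hG (x := fun i => a (m + 1 - i)) (y := fun i => b (m + 1 - i))
        (I1 := J1) (I4 := J4) (c := J2)
        ⟨AN_symm G, Or.inr ⟨?_, ?_⟩, ?_, ?_, ?_, ?_, ?_⟩ ?_ ?_
      · intro i j hij hj; exact hoa _ _ (by omega) (by omega)
      · intro i j hij hj; exact hs _ _ (by omega) (by omega)
      · rcases hob with h | h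
        · right; intro i j hij hj; exact h _ _ (by omega) (by omega)
        · left; intro i j hij hj; exact h _ _ (by omega) (by omega)
      · intro i j hij hj; rw [AN_symm]; exact h1 _ _ (by omega) (by omega)
      · intro i j hij hj; rw [AN_symm]; exact h4 _ _ (by omega) (by omega)
      · intro i hi; rw [h3 _ _ (by omega) (by omega)]; tauto
      · intro i j hij hj; exact h2 _ _ (by omega) (by omega)
      · intro i hi; exact ha _ (by omega)
      · intro i hi; exact hb _ (by omega)

end

/-- compositions with parts in `[1,k]` -/
lemma comps_exist (k n : ℕ) : ∃ C : Finset (List ℕ), C.card = genFib k n ∧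
    ∀ L ∈ C, L.sum = n ∧ ∀ a ∈ L, 1 ≤ a ∧ a ≤ k := by
  classical
  induction n using Nat.strong_induction_on with
  | _ n ih =>
    rcases n with _ | n
    · exact ⟨{[]}, by simp [genFib], by simp⟩
    · have ih' : ∀ j : ℕ, ∃ C : Finset (List ℕ), j < n + 1 → (C.card = genFib k j ∧
        ∀ L ∈ C, L.sum = j ∧ ∀ a ∈ L, 1 ≤ a ∧ a ≤ k) := by
        intro j
        by_cases hj : j < n + 1
        · obtain ⟨C, hC⟩ := ih j hj
          exact ⟨C, fun _ => hC⟩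
        · exact ⟨∅, fun h => absurd h hj⟩
      choose C hC using ih'
      refine ⟨(Finset.range k).biUnion (fun i => if i ≤ n then
        (C (n - i)).image (List.cons (i + 1)) else ∅), ?_, ?_⟩
      · rw [Finset.card_biUnion, genFib_succ]
        · apply Finset.sum_congr rfl
          intro i _
          split_ifs with h
          · rw [Finset.card_image_of_injective _ (List.cons_injective)]
            exact (hC _ (by omega)).1
          · simp
        · intro i _ j _ hij
          rw [Function.onFun, Finset.disjoint_left]
          intro L h1 h2
          split_ifs at h1 h2 <;> simp at h1 h2
          obtain ⟨L1, -, rfl⟩ := h1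
          obtain ⟨L2, -, h⟩ := h2
          simp at h
          omega
      · intro L hL
        rw [Finset.mem_biUnion] at hL
        obtain ⟨i, hi, hL⟩ := hL
        rw [Finset.mem_range] at hi
        split_ifs at hL with h
        · rw [Finset.mem_image] at hL
          obtain ⟨L', h1, rfl⟩ := hL
          have h2 := (hC (n - i) (by omega)).2 L' h1
          refine ⟨by rw [List.sum_cons, h2.1]; omega, ?_⟩
          intro a ha
          rcases List.mem_cons.1 ha with rfl | ha
          · omega
          · exact h2.2 a ha
        · simp at hL

/-- vertex of a composition -/
def vt (g : ℕ → ℕ → ℕ) (ℓ : ℕ) : ℕ → List ℕ → ℕ → ℕ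
  | _, [], _ => 0
  | i, a :: L, p => if p + 1 < a then g i p else if p + 1 = a then g i ℓ
      else vt g ℓ (i + 1) L (p - a)

lemma vt_form (g : ℕ → ℕ → ℕ) (ℓ : ℕ) (L : List ℕ) : ∀ (i p : ℕ),
    (∀ a ∈ L, 1 ≤ a ∧ a ≤ ℓ + 1) → p < L.sum →
    ∃ j t, i ≤ j ∧ j < i + L.length ∧ t ≤ ℓ ∧ vt g ℓ i L p = g j t := by
  induction L with
  | nil => intro i p _ hp; simp at hp
  | cons a L ih =>
    intro i p hL hp
    have ha := hL a (by simp)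
    unfold vt
    split_ifs with h1 h2
    · exact ⟨i, p, le_rfl, by simp, by omega, rfl⟩
    · exact ⟨i, ℓ, le_rfl, by simp, by omega, rfl⟩
    · obtain ⟨j, t, h3, h4, h5, h6⟩ := ih (i + 1) (p - a)
        (fun b hb => hL b (by simp [hb])) (by rw [List.sum_cons] at hp; omega)
      exact ⟨j, t, by omega, by simp; omega, h5, h6⟩

lemma vt_mono (g : ℕ → ℕ → ℕ) (ℓ T : ℕ) (hg1 : ∀ i < T, ∀ s t, s < t → t ≤ ℓ → g i s < g i t)
    (hg2 : ∀ i j s t, i < j → j < T → s ≤ ℓ → t ≤ ℓ → g i s < g j t) (L : List ℕ) :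
    ∀ (i p q : ℕ), (∀ a ∈ L, 1 ≤ a ∧ a ≤ ℓ + 1) → i + L.length ≤ T → p < q → q < L.sum →
    vt g ℓ i L p < vt g ℓ i L q := by
  induction L with
  | nil => intro i p q _ _ _ hp; simp at hp
  | cons a L ih =>
    intro i p q hL hT hpq hq
    have ha := hL a (by simp)
    have hL' : ∀ b ∈ L, 1 ≤ b ∧ b ≤ ℓ + 1 := fun b hb => hL b (by simp [hb])
    rw [List.sum_cons] at hq
    rw [List.length_cons] at hT
    by_cases h1 : q < a
    · have hp : p + 1 < a := by omega
      unfold vt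
      rw [if_pos hp]
      split_ifs with h2 h3
      · exact hg1 _ (by omega) _ _ hpq (by omega)
      · exact hg1 _ (by omega) _ _ (by omega) (by omega)
      · omega
    · have hq1 : vt g ℓ i (a :: L) q = vt g ℓ (i + 1) L (q - a) := by
        rw [vt, if_neg (by omega), if_neg (by omega)]
      rw [hq1]
      by_cases h2 : p < a
      · obtain ⟨j, t, h3, h4, h5, h6⟩ := vt_form g ℓ L (i + 1) (q - a) hL' (by omega)
        rw [h6]
        unfold vt
        split_ifs
        · exact hg2 _ _ _ _ (by omega) (by omega) (by omega) (by omega)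
        · exact hg2 _ _ _ _ (by omega) (by omega) (by omega) (by omega)
        · omega
      · rw [vt, if_neg (by omega), if_neg (by omega)]
        exact ih _ _ _ hL' (by omega) (by omega) (by omega)

lemma vt_inj_aux (A : ℕ → ℕ → Prop) (c : Prop) (g : ℕ → ℕ → ℕ) (ℓ T : ℕ)
    (hd : ∀ i < T, (A (g i 0) (g i ℓ) ↔ ¬ c))
    (hc : ∀ i j s t, i < j → j < T → s ≤ ℓ → t ≤ ℓ → (A (g i s) (g j t) ↔ c))
    (i a a' : ℕ) (L L' : List ℕ) (hL : ∀ b ∈ a :: L, 1 ≤ b ∧ b ≤ ℓ + 1)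
    (hT : i + (a :: L).length ≤ T) (hs : (a :: L).sum = (a' :: L').sum) (haa : a < a')
    (h : ∀ p q, p < q → q < (a :: L).sum → (A (vt g ℓ i (a :: L) p) (vt g ℓ i (a :: L) q) ↔
      A (vt g ℓ i (a' :: L') p) (vt g ℓ i (a' :: L') q))) : False := by
  have ha := hL a (by simp)
  have hL' : ∀ b ∈ L, 1 ≤ b ∧ b ≤ ℓ + 1 := fun b hb => hL b (by simp [hb])
  rw [List.sum_cons, List.sum_cons] at hs
  rw [List.length_cons] at hT
  have h1 := h 0 (a' - 1) (by omega) (by rw [List.sum_cons]; omega)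
  have e1 : vt g ℓ i (a' :: L') 0 = g i 0 := by rw [vt, if_pos (by omega)]
  have e2 : vt g ℓ i (a' :: L') (a' - 1) = g i ℓ := by
    rw [vt, if_neg (by omega), if_pos (by omega)]
  have e3 : vt g ℓ i (a :: L) (a' - 1) = vt g ℓ (i + 1) L (a' - 1 - a) := by
    rw [vt, if_neg (by omega), if_neg (by omega)]
  have e4 : ∃ t ≤ ℓ, vt g ℓ i (a :: L) 0 = g i t := by
    unfold vt
    split_ifs
    · exact ⟨0, by omega, rfl⟩
    · exact ⟨ℓ, le_rfl, rfl⟩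
    · omega
  obtain ⟨t, ht, e4⟩ := e4
  obtain ⟨j, s, h3, h4, h5, h6⟩ := vt_form g ℓ L (i + 1) (a' - 1 - a) hL' (by omega)
  rw [e1, e2, e3, e4, h6, hd _ (by omega), hc _ _ _ _ (by omega) (by omega) ht h5] at h1
  tauto

lemma vt_inj (A : ℕ → ℕ → Prop) (c : Prop) (g : ℕ → ℕ → ℕ) (ℓ T : ℕ)
    (hd : ∀ i < T, (A (g i 0) (g i ℓ) ↔ ¬ c))
    (hc : ∀ i j s t, i < j → j < T → s ≤ ℓ → t ≤ ℓ → (A (g i s) (g j t) ↔ c)) (L : List ℕ) :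
    ∀ (L' : List ℕ) (i : ℕ), (∀ b ∈ L, 1 ≤ b ∧ b ≤ ℓ + 1) → (∀ b ∈ L', 1 ≤ b ∧ b ≤ ℓ + 1) →
    i + L.length ≤ T → i + L'.length ≤ T → L.sum = L'.sum →
    (∀ p q, p < q → q < L.sum → (A (vt g ℓ i L p) (vt g ℓ i L q) ↔
      A (vt g ℓ i L' p) (vt g ℓ i L' q))) → L = L' := by
  induction L with
  | nil =>
    intro L' i _ hL' _ _ hs _
    rcases L' with _ | ⟨a, L'⟩
    · rfl
    · have := hL' a (by simp)
      simp at hs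
      omega
  | cons a L ih =>
    intro L' i hL hL' hT hT' hs h
    rcases L' with _ | ⟨a', L'⟩
    · have := hL a (by simp)
      simp at hs
      omega
    · rcases lt_trichotomy a a' with haa | haa | haa
      · exact (vt_inj_aux A c g ℓ T hd hc i a a' L L' hL hT hs haa h).elim
      · subst haa
        have ha := hL a (by simp)
        rw [List.length_cons] at hT hT'
        rw [List.sum_cons, List.sum_cons] at hs
        rw [ih L' (i + 1) (fun b hb => hL b (by simp [hb])) (fun b hb => hL' b (by simp [hb]))
          (by omega) (by omega) (by omega) ?_]
        intro p q hpq hq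
        have e : ∀ (L : List ℕ) p, vt g ℓ i (a :: L) (p + a) = vt g ℓ (i + 1) L p := by
          intro L p
          rw [vt, if_neg (by omega), if_neg (by omega)]
          simp
        have := h (p + a) (q + a) (by omega) (by rw [List.sum_cons]; omega)
        rwa [e, e, e, e] at this
      · refine (vt_inj_aux A c g ℓ T hd hc i a' a L' L hL' hT' hs.symm haa ?_).elim
        intro p q hpq hq
        exact (h p q hpq (by rw [hs]; exact hq)).symm

lemma length_le_sum (L : List ℕ) (h : ∀ b ∈ L, 1 ≤ b) : L.length ≤ L.sum := by
  induction L with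
  | nil => simp
  | cons a L ih =>
    have := ih (fun b hb => h b (by simp [hb]))
    have := h a (by simp)
    simp
    omega

lemma type3_count (P : HerProp) {N n : ℕ} (G : SimpleGraph (Fin N)) (hG : G ∈ P.mem N)
    (c : Prop) (g : ℕ → ℕ → ℕ) (ℓ : ℕ) (hN : ∀ i < n, ∀ t ≤ ℓ, g i t < N)
    (hg1 : ∀ i < n, ∀ s t, s < t → t ≤ ℓ → g i s < g i t)
    (hg2 : ∀ i j s t, i < j → j < n → s ≤ ℓ → t ≤ ℓ → g i s < g j t)
    (hd : ∀ i < n, (AN G (g i 0) (g i ℓ) ↔ ¬ c))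
    (hc : ∀ i j s t, i < j → j < n → s ≤ ℓ → t ≤ ℓ → (AN G (g i s) (g j t) ↔ c)) :
    genFib (ℓ + 1) n ≤ speed P n := by
  classical
  obtain ⟨C, hC, hCL⟩ := comps_exist (ℓ + 1) n
  have hlen : ∀ L ∈ C, 0 + L.length ≤ n := by
    intro L hL
    have := length_le_sum L (fun b hb => ((hCL L hL).2 b hb).1)
    rw [(hCL L hL).1] at this
    omega
  have := count_mono P (n := n) G hG (ι := C) (fun L p => vt g ℓ 0 L.1 p) ?_ ?_ ?_
  · rwa [Fintype.card_coe, hC] at this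
  · intro L p
    obtain ⟨j, t, h3, h4, h5, h6⟩ := vt_form g ℓ L.1 0 p (hCL _ L.2).2
      (by rw [(hCL _ L.2).1]; exact p.2)
    have := hlen _ L.2
    simp only [h6]
    exact hN _ (by omega) _ h5
  · intro L p q hpq
    exact vt_mono g ℓ n hg1 hg2 L.1 0 p q (hCL _ L.2).2 (hlen _ L.2) hpq
      (by rw [(hCL _ L.2).1]; exact q.2)
  · intro L L' h
    apply Subtype.ext
    refine vt_inj (AN G) c g ℓ n hd hc L.1 L'.1 0 (hCL _ L.2).2 (hCL _ L'.2).2 (hlen _ L.2)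
      (hlen _ L'.2) (by rw [(hCL _ L.2).1, (hCL _ L'.2).1]) ?_
    intro p q hpq hq
    rw [(hCL _ L.2).1] at hq
    exact h ⟨p, by omega⟩ ⟨q, hq⟩

/-- Type 3 structures. -/
lemma type3 (ℓ m : ℕ) (hℓ : 1 ≤ ℓ) : ∃ T : ℕ, ∀ (P : HerProp) (N : ℕ) (G : SimpleGraph (Fin N)),
    G ∈ P.mem N → ∀ lo hi : Bool → ℕ → ℕ,
    (∀ b, ∀ i < T, hi b i < N) → (∀ b, ∀ i < T, lo b i + ℓ ≤ hi b i) →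
    (∀ b b' i j, i < j → j < T → hi b i < lo b' j) →
    (∀ b, ∀ i < T, (AN G (lo b i) (hi b i) ↔ b = true)) →
    genFib (ℓ + 1) (m + 1) ≤ speed P (m + 1) := by
  classical
  obtain ⟨T, hT⟩ := ramsey ((Bool × Fin (ℓ + 1)) → (Bool × Fin (ℓ + 1)) → Prop) (m + 1)
  refine ⟨T, fun P N G hG lo hi hN hlh hsep hA => ?_⟩
  let u : ℕ → Bool × Fin (ℓ + 1) → ℕ := fun i s =>
    if (s.2 : ℕ) < ℓ then lo s.1 i + s.2 else hi s.1 i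
  obtain ⟨r, k, h1, h2⟩ := hT (fun i j s t => AN G (u i s) (u j t))
  have hu1 : ∀ i < T, ∀ s, lo s.1 i ≤ u i s ∧ u i s ≤ hi s.1 i := by
    intro i hi' s
    have := hlh s.1 i hi'
    simp only [u]
    split_ifs <;> omega
  have hk : ∀ i j s t, i < j → j < m + 1 → (AN G (u (r i) s) (u (r j) t) ↔ k s t) := by
    intro i j s t hij hj
    have := congrFun (congrFun (h2 i j hij hj).2 s) t
    exact this ▸ Iff.rfl
  have hlt : ∀ i j s t, i < j → j < m + 1 → u (r i) s < u (r j) t := by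
    intro i j s t hij hj
    have a1 := hu1 (r i) (h1 i (by omega)) s
    have a2 := hu1 (r j) (h1 j (by omega)) t
    have a3 := hsep s.1 t.1 (r i) (r j) (h2 i j hij hj).1 (h1 j (by omega))
    omega
  have huN : ∀ i < m + 1, ∀ s, u (r i) s < N := by
    intro i hi' s
    have a1 := hu1 (r i) (h1 i hi') s
    have := hN s.1 (r i) (h1 i hi')
    omega
  by_cases hrow : ∃ s t t', ¬ (k s t ↔ k s t')
  · obtain ⟨s, t, t', hne⟩ := hrow
    refine (genFib_le _ _).trans (type1 P G hG (u (r 0) s)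
      (fun b i => u (r (i + 1)) (if b then t else t')) (huN 0 (by omega) s) ?_ ?_ (Or.inl ?_) ?_)
    · intro b i hi'; exact huN _ (by omega) _
    · intro b b' i j hij hj; exact hlt _ _ _ _ (by omega) (by omega)
    · intro b i hi'; exact hlt _ _ _ _ (by omega) (by omega)
    · intro i hi'
      rw [hk _ _ _ _ (by omega) (by omega), hk _ _ _ _ (by omega) (by omega)]
      simpa using hne
  by_cases hcol : ∃ s s' t, ¬ (k s t ↔ k s' t)
  · obtain ⟨s, s', t, hne⟩ := hcol
    refine (genFib_le _ _).trans (type1 P G hG (u (r m) t)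
      (fun b i => u (r i) (if b then s else s')) (huN m (by omega) t) ?_ ?_ (Or.inr ?_) ?_)
    · intro b i hi'; exact huN _ (by omega) _
    · intro b b' i j hij hj; exact hlt _ _ _ _ (by omega) (by omega)
    · intro b i hi'; exact hlt _ _ _ _ (by omega) (by omega)
    · intro i hi'
      rw [AN_symm, hk _ _ _ _ (by omega) (by omega), AN_symm,
        hk _ _ _ _ (by omega) (by omega)]
      simpa using hne
  push Not at hrow hcol
  have hconst : ∀ s t s' t', k s t ↔ k s' t' := fun s t s' t' =>
    (hrow s t t').trans (hcol s s' t')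
  let s0 : Bool × Fin (ℓ + 1) := (true, 0)
  let b : Bool := decide (¬ k s0 s0)
  have hf : ∀ t ≤ ℓ, t < ℓ + 1 := fun t ht => by omega
  let sl : ℕ → Bool × Fin (ℓ + 1) := fun t => (b, Fin.ofNat (ℓ + 1) t)
  have hsl : ∀ i t, t ≤ ℓ → u i (sl t) = if t < ℓ then lo b i + t else hi b i := by
    intro i t ht
    simp only [u, sl, Fin.ofNat]
    rw [Nat.mod_eq_of_lt (hf t ht)]
  refine type3_count P G hG (k s0 s0) (fun i t => u (r i) (sl t)) ℓ ?_ ?_ ?_ ?_ ?_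
  · intro i hi' t ht; exact huN i hi' _
  · intro i hi' s t hst ht
    have := hlh b (r i) (h1 i hi')
    rw [hsl _ _ (by omega), hsl _ _ ht, if_pos (by omega)]
    split_ifs <;> omega
  · intro i j s t hij hj hs ht; exact hlt _ _ _ _ hij hj
  · intro i hi'
    have h3 := hA b (r i) (h1 i hi')
    have e1 : u (r i) (sl ℓ) = hi b (r i) := by rw [hsl _ _ le_rfl, if_neg (by omega)]
    have e0 : u (r i) (sl 0) = lo b (r i) := by
      rw [hsl _ _ (by omega), if_pos (by omega)]; simp
    rw [e0, e1, h3]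
    simp [b]
  · intro i j s t hij hj hs ht
    rw [hk _ _ _ _ hij hj]
    exact hconst _ _ _ _

/-- `v` witnesses that `x < x'` are not `ℓ`-homogeneous. -/
def Bad {N : ℕ} (G : SimpleGraph (Fin N)) (ℓ x x' v : ℕ) : Prop :=
  x' < N ∧ v < N ∧ x < x' ∧ (x + ℓ ≤ v ∨ v + ℓ ≤ x) ∧ (x' + ℓ ≤ v ∨ v + ℓ ≤ x') ∧
    ¬ (AN G x v ↔ AN G x' v)

lemma lHom_of_not_bad {N : ℕ} (G : SimpleGraph (Fin N)) (ℓ : ℕ) (x y : Fin N)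
    (h : ∀ v, ¬ Bad G ℓ x y v) (h' : ∀ v, ¬ Bad G ℓ y x v) : lHom G ℓ x y := by
  intro v h1 h2
  by_contra hne
  rw [← AN_iff, ← AN_iff] at hne
  rcases lt_trichotomy x y with hxy | hxy | hxy
  · exact h v ⟨y.2, v.2, hxy, by omega, by omega, hne⟩
  · subst hxy; exact hne Iff.rfl
  · exact h' v ⟨x.2, v.2, hxy, by omega, by omega, fun e => hne e.symm⟩

lemma blocks {N : ℕ} (G : SimpleGraph (Fin N)) (ℓ j : ℕ) : ∀ s : ℕ,
    (∃ c : ℕ → ℕ, Monotone c ∧ (∀ x, c x < 2 * j + 1) ∧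
      ∀ x y : Fin N, s ≤ x → s ≤ y → c x = c y → lHom G ℓ x y) ∨
    ∃ x x' v : ℕ → ℕ, (∀ i < j, Bad G ℓ (x i) (x' i) (v i) ∧ s ≤ x i) ∧
      ∀ i k, i < k → k < j → x' i < x k := by
  classical
  induction j with
  | zero => intro s; right; exact ⟨id, id, id, by simp, by simp⟩
  | succ j ih =>
    intro s
    by_cases hex : ∃ e, ∃ x v, s ≤ x ∧ Bad G ℓ x e v
    · obtain ⟨e, ⟨x0, v0, hs0, hb0⟩, hmin⟩ : ∃ e, (∃ x v, s ≤ x ∧ Bad G ℓ x e v) ∧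
          ∀ e' < e, ∀ x v, s ≤ x → ¬ Bad G ℓ x e' v :=
        ⟨Nat.find hex, Nat.find_spec hex,
          fun e' h1 x v h2 h3 => Nat.find_min hex h1 ⟨x, v, h2, h3⟩⟩
      have hx0e : x0 < e := hb0.2.2.1
      rcases ih (e + 1) with ⟨c, hc1, hc2, hc3⟩ | ⟨x, x', v, h1, h2⟩
      · left
        refine ⟨fun x => if x < e then 0 else if x = e then 1 else c x + 2, ?_, ?_, ?_⟩
        · intro a b hab
          have := hc1 hab
          simp only
          split_ifs <;> omega
        · intro x
          have := hc2 x
          simp only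
          split_ifs <;> omega
        · intro x y hx hy hxy
          have hcase : ((x : ℕ) < e ∧ (y : ℕ) < e) ∨ ((x : ℕ) = e ∧ (y : ℕ) = e) ∨
              (e + 1 ≤ (x : ℕ) ∧ e + 1 ≤ (y : ℕ) ∧ c x = c y) := by
            revert hxy
            dsimp only
            split_ifs <;> intro hxy <;> first | omega | simp_all
          rcases hcase with ⟨q1, q2⟩ | ⟨q1, q2⟩ | ⟨q1, q2, q3⟩
          · apply lHom_of_not_bad
            · intro v; exact hmin _ q2 _ _ hx
            · intro v; exact hmin _ q1 _ _ hy
          · have : x = y := Fin.ext (q1.trans q2.symm)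
            subst this
            intro v _ _; exact Iff.rfl
          · exact hc3 x y q1 q2 q3
      · right
        refine ⟨fun i => Nat.casesOn i x0 x, fun i => Nat.casesOn i e x',
          fun i => Nat.casesOn i v0 v, ?_, ?_⟩
        · rintro (_ | i) hi
          · exact ⟨hb0, hs0⟩
          · have := h1 i (by omega)
            exact ⟨this.1, by show s ≤ x i; omega⟩
        · rintro (_ | i) (_ | k) hik hk
          · omega
          · have := h1 k (by omega)
            show e < x k
            omega
          · omega
          · exact h2 i k (by omega) (by omega)
    · left
      push Not at hex
      refine ⟨fun _ => 0, monotone_const, by simp, ?_⟩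
      intro x y hx hy _
      apply lHom_of_not_bad
      · intro v; exact hex _ _ _ hx
      · intro v; exact hex _ _ _ hy

lemma prop_aux1 {a b c : Prop} (h1 : a ↔ b) (h2 : ¬ a ↔ c) : ¬ (b ↔ c) := by tauto

lemma prop_aux2 {a b c : Prop} (h1 : ¬ (a ↔ b)) (h2 : a ↔ c) : b ↔ ¬ c := by tauto

lemma switch_aux (F : Bool → Prop) (h : ¬ (F true ↔ F false)) (f : Bool → Bool)
    (hf : (F true ∧ ∀ b, f b = b) ∨ (¬ F true ∧ ∀ b, f b = !b)) (b : Bool) :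
    F (f b) ↔ b = true := by
  rcases hf with ⟨h1, h2⟩ | ⟨h1, h2⟩ <;> rw [h2] <;> cases b <;> simp <;> tauto

/-- Non-local witnesses: the sequence `v` lies entirely on one side. -/
lemma far (P : HerProp) {N m : ℕ} (G : SimpleGraph (Fin N)) (hG : G ∈ P.mem N)
    (x x' v : ℕ → ℕ) (k : Fin 10 → Prop)
    (hx' : ∀ i < m + 2, x' i < N) (hv : ∀ i < m + 2, v i < N)
    (hxx : ∀ i < m + 2, x i < x' i) (hsep : ∀ i j, i < j → j < m + 2 → x' i < x j)
    (hside : (∀ i j, i < m + 2 → j < m + 2 → x' i < v j) ∨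
      (∀ i j, i < m + 2 → j < m + 2 → v j < x i))
    (hdiff : ∀ i < m + 2, ¬ (AN G (x i) (v i) ↔ AN G (x' i) (v i)))
    (hk0 : ∀ i < m + 2, (AN G (x i) (v i) ↔ k 0))
    (hk1 : ∀ i j, i < j → j < m + 2 → (v i < v j ↔ k 1))
    (hk2 : ∀ i j, i < j → j < m + 2 → (v i = v j ↔ k 2))
    (hk3 : ∀ i j, i < j → j < m + 2 → (AN G (x i) (x j) ↔ k 3))
    (hk4 : ∀ i j, i < j → j < m + 2 → (AN G (x' i) (x' j) ↔ k 4))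
    (hk5 : ∀ i j, i < j → j < m + 2 → (AN G (v i) (v j) ↔ k 5))
    (hk6 : ∀ i j, i < j → j < m + 2 → (AN G (x i) (v j) ↔ k 6))
    (hk7 : ∀ i j, i < j → j < m + 2 → (AN G (x j) (v i) ↔ k 7))
    (hk8 : ∀ i j, i < j → j < m + 2 → (AN G (x' i) (v j) ↔ k 8))
    (hk9 : ∀ i j, i < j → j < m + 2 → (AN G (x' j) (v i) ↔ k 9)) :
    2 ^ m ≤ speed P (m + 1) := by
  have t1 : (∀ i < m, ¬ (AN G (x (i + 1)) (v 0) ↔ AN G (x' (i + 1)) (v 0))) →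
      2 ^ m ≤ speed P (m + 1) := by
    intro hh
    refine type1 P G hG (v 0) (fun b i => if b then x (i + 1) else x' (i + 1))
      (hv 0 (by omega)) ?_ ?_ ?_ ?_
    · intro b i hi
      have := hx' (i + 1) (by omega)
      have := hxx (i + 1) (by omega)
      try dsimp only
      split_ifs <;> omega
    · intro b b' i j hij hj
      have := hxx (i + 1) (by omega)
      have := hxx (j + 1) (by omega)
      have := hsep (i + 1) (j + 1) (by omega) (by omega)
      try dsimp only
      split_ifs <;> omega
    · rcases hside with h | h
      · right
        intro b i hi
        have := hxx (i + 1) (by omega)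
        have := h (i + 1) 0 (by omega) (by omega)
        try dsimp only
        split_ifs <;> omega
      · left
        intro b i hi
        have := hxx (i + 1) (by omega)
        have := h (i + 1) 0 (by omega) (by omega)
        try dsimp only
        split_ifs <;> omega
    · intro i hi
      have := hh i hi
      rw [AN_symm G (v 0), AN_symm G (v 0)]
      simpa using this
  by_cases h2 : k 2
  · apply t1
    intro i hi
    rw [(hk2 0 (i + 1) (by omega) (by omega)).2 h2]
    exact hdiff _ (by omega)
  have hob : (∀ i j, i < j → j < m + 2 → v i < v j) ∨ (∀ i j, i < j → j < m + 2 → v j < v i) := by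
    by_cases h1 : k 1
    · left; intro i j hij hj; exact (hk1 i j hij hj).2 h1
    · right; intro i j hij hj
      have a1 := hk1 i j hij hj
      have a2 := hk2 i j hij hj
      have b1 : ¬ v i < v j := fun e => h1 (a1.1 e)
      have b2 : ¬ v i = v j := fun e => h2 (a2.1 e)
      omega
  by_cases c1 : (k 6 ↔ k 7) ∧ (k 0 ↔ k 7)
  · by_cases c2 : (k 8 ↔ k 9) ∧ (¬ k 0 ↔ k 9)
    · apply t1
      intro i hi
      rw [hk7 0 (i + 1) (by omega) (by omega), hk9 0 (i + 1) (by omega) (by omega)]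
      exact prop_aux1 c1.2 c2.2
    · refine type2 P G hG x' v (k 4) (k 5) (¬ k 0) (k 8) (k 9) hx' hv ?_ ?_ hob hk4 hk5 hk8 hk9
        ?_ c2
      · rcases hside with h | h
        · left; exact h
        · right; intro i j hi hj
          exact (h i j hi hj).trans (hxx i hi)
      · intro i j hij hj
        exact (hsep i j hij hj).trans (hxx j hj)
      · intro i hi
        have := hdiff i hi
        exact prop_aux2 this (hk0 i hi)
  · refine type2 P G hG x v (k 3) (k 5) (k 0) (k 6) (k 7)
      (fun i hi => (hxx i hi).trans (hx' i hi)) hv ?_ ?_ hob hk3 hk5 hk6 hk7 hk0 c1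
    · rcases hside with h | h
      · left; intro i j hi hj
        exact (hxx i hi).trans (h i j hi hj)
      · right; exact h
    · intro i j hij hj
      exact (hxx i (by omega)).trans (hsep i j hij hj)

/-- Many disjoint bad pairs force large speed. -/
lemma many_bad (ℓ m : ℕ) (hℓ : 1 ≤ ℓ) : ∃ K : ℕ, ∀ (P : HerProp) (N : ℕ)
    (G : SimpleGraph (Fin N)), G ∈ P.mem N → ∀ x x' v : ℕ → ℕ,
    (∀ i < K, Bad G ℓ (x i) (x' i) (v i)) → (∀ i j, i < j → j < K → x' i < x j) →
    genFib (ℓ + 1) (m + 1) ≤ speed P (m + 1) := by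
  classical
  obtain ⟨T0, hT0⟩ := type3 ℓ m hℓ
  obtain ⟨T, hT⟩ : ∃ T, T = T0 + m + 5 := ⟨_, rfl⟩
  obtain ⟨K, hK⟩ := ramsey ((Fin 10 → Prop) × (Fin 4 → Prop)) (T + 1)
  refine ⟨K, fun P N G hG X X' V hbad hsepK => ?_⟩
  obtain ⟨r, ⟨k, l⟩, hr, hrr⟩ := hK (fun i j => (![AN G (X i) (V i), V i < V j, V i = V j,
    AN G (X i) (X j), AN G (X' i) (X' j), AN G (V i) (V j), AN G (X i) (V j), AN G (X j) (V i),
    AN G (X' i) (V j), AN G (X' j) (V i)], ![V i < X i, V i < X' i, V i < X j, X' i < V j]))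
  set x : ℕ → ℕ := fun i => X (r i) with hx
  set x' : ℕ → ℕ := fun i => X' (r i) with hx'
  set v : ℕ → ℕ := fun i => V (r i) with hv
  have hb : ∀ i < T, Bad G ℓ (x i) (x' i) (v i) := fun i hi => hbad _ (hr i (by omega))
  have hsep : ∀ i j, i < j → j < T → x' i < x j := fun i j hij hj =>
    hsepK _ _ (hrr i j hij (by omega)).1 (hr j (by omega))
  have hxx : ∀ i < T, x i < x' i := fun i hi => (hb i hi).2.2.1
  have hk : ∀ i j, i < j → j < T + 1 → ![AN G (x i) (v i), v i < v j, v i = v j,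
    AN G (x i) (x j), AN G (x' i) (x' j), AN G (v i) (v j), AN G (x i) (v j), AN G (x j) (v i),
    AN G (x' i) (v j), AN G (x' j) (v i)] = k := fun i j hij hj =>
      congrArg Prod.fst (hrr i j hij hj).2
  have hl : ∀ i j, i < j → j < T + 1 → ![v i < x i, v i < x' i, v i < x j, x' i < v j] = l :=
    fun i j hij hj => congrArg Prod.snd (hrr i j hij hj).2
  have hl0 : ∀ i < T, (v i < x i ↔ l 0) := fun i hi => by
    rw [← hl i (i + 1) (by omega) (by omega)]; rfl
  have hl1 : ∀ i < T, (v i < x' i ↔ l 1) := fun i hi => by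
    rw [← hl i (i + 1) (by omega) (by omega)]; rfl
  have hl2 : ∀ i j, i < j → j < T → (v i < x j ↔ l 2) := fun i j hij hj => by
    rw [← hl i j hij (by omega)]; rfl
  have hl3 : ∀ i j, i < j → j < T → (x' i < v j ↔ l 3) := fun i j hij hj => by
    rw [← hl i j hij (by omega)]; rfl
  have hfar : ((∀ i j, i < m + 2 → j < m + 2 → x' (i + 1) < v (j + 1)) ∨
      (∀ i j, i < m + 2 → j < m + 2 → v (j + 1) < x (i + 1))) →
      genFib (ℓ + 1) (m + 1) ≤ speed P (m + 1) := by
    intro hside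
    refine (genFib_le _ _).trans (far P G hG (fun i => x (i + 1)) (fun i => x' (i + 1))
      (fun i => v (i + 1)) k (fun i hi => (hb (i + 1) (by omega)).1)
      (fun i hi => (hb (i + 1) (by omega)).2.1) (fun i hi => hxx (i + 1) (by omega))
      (fun i j hij hj => hsep (i + 1) (j + 1) (by omega) (by omega)) hside
      (fun i hi => (hb (i + 1) (by omega)).2.2.2.2.2) ?_ ?_ ?_ ?_ ?_ ?_ ?_ ?_ ?_ ?_)
    · intro i hi
      rw [← hk (i + 1) (i + 2) (by omega) (by omega)]; rfl
    all_goals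
      intro i j hij hj
      rw [← hk (i + 1) (j + 1) (by omega) (by omega)]; rfl
  -- local case
  have hloc : ∀ lo hi : ℕ → Bool → ℕ, (∀ i < T, ∀ b, hi i b < N) →
      (∀ i < T, ∀ b, lo i b + ℓ ≤ hi i b) →
      (∀ i j b b', i < j → j < T → hi i b < lo j b') →
      (∀ i < T, ¬ (AN G (lo i true) (hi i true) ↔ AN G (lo i false) (hi i false))) →
      genFib (ℓ + 1) (m + 1) ≤ speed P (m + 1) := by
    intro lo hi h1 h2 h3 h4
    let sw : ℕ → Bool → Bool := fun i b => if AN G (lo i true) (hi i true) then b else !b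
    refine hT0 P N G hG (fun b i => lo i (sw i b)) (fun b i => hi i (sw i b)) ?_ ?_ ?_ ?_
    · intro b i hi'; exact h1 _ (by omega) _
    · intro b i hi'; exact h2 _ (by omega) _
    · intro b b' i j hij hj; exact h3 _ _ _ _ hij (by omega)
    · intro b i hi'
      refine switch_aux (fun b => AN G (lo i b) (hi i b)) (h4 i (by omega)) (sw i) ?_ b
      by_cases e : AN G (lo i true) (hi i true)
      · exact Or.inl ⟨e, fun b => if_pos e⟩
      · exact Or.inr ⟨e, fun b => if_neg e⟩
  by_cases c0 : l 0
  · -- v left of x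
    have hlt : ∀ i < T, v i < x i := fun i hi => (hl0 i hi).2 c0
    by_cases c3 : l 3
    · refine hloc (fun i _ => v i) (fun i b => if b then x i else x' i) ?_ ?_ ?_ ?_
      · intro i hi b
        have := (hb i hi).1
        have := hxx i hi
        try dsimp only
        split_ifs <;> omega
      · intro i hi b
        obtain ⟨-, -, a1, a2, a3, -⟩ := hb i hi
        have := hlt i hi
        try dsimp only
        split_ifs <;> omega
      · intro i j b b' hij hj
        have := (hl3 i j hij hj).2 c3
        have := hxx i (by omega)
        try dsimp only
        split_ifs <;> omega
      · intro i hi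
        have := (hb i hi).2.2.2.2.2
        rw [AN_symm G (v i), AN_symm G (v i)]
        simpa using this
    · apply hfar
      right
      have hn : ∀ i j, i < j → j < T → v j ≤ x' i := fun i j hij hj =>
        not_lt.1 (fun e => c3 ((hl3 i j hij hj).1 e))
      intro i j hi hj
      have a1 := hn 0 (j + 1) (by omega) (by omega)
      have a2 := hsep 0 (i + 1) (by omega) (by omega)
      omega
  · have hge : ∀ i < T, x i < v i := fun i hi => by
      have a1 : ¬ v i < x i := fun e => c0 ((hl0 i hi).1 e)
      obtain ⟨-, -, -, a2, -, -⟩ := hb i hi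
      omega
    by_cases c1 : l 1
    · -- v between
      have hlt : ∀ i < T, v i < x' i := fun i hi => (hl1 i hi).2 c1
      refine hloc (fun i b => if b then x i else v i) (fun i b => if b then v i else x' i)
        ?_ ?_ ?_ ?_
      · intro i hi b
        have := (hb i hi).1
        have := (hb i hi).2.1
        try dsimp only
        split_ifs <;> omega
      · intro i hi b
        obtain ⟨-, -, a1, a2, a3, -⟩ := hb i hi
        have := hlt i hi
        have := hge i hi
        try dsimp only
        split_ifs <;> omega
      · intro i j b b' hij hj
        have := hsep i j hij hj
        have := hlt i (by omega)
        have := hge j (by omega)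
        try dsimp only
        split_ifs <;> omega
      · intro i hi
        have := (hb i hi).2.2.2.2.2
        simp only [if_true, Bool.false_eq_true, if_false]
        rw [AN_symm G (v i)]
        exact this
    · -- v right
      have hgt : ∀ i < T, x' i < v i := fun i hi => by
        have a1 : ¬ v i < x' i := fun e => c1 ((hl1 i hi).1 e)
        obtain ⟨-, -, -, -, a2, -⟩ := hb i hi
        omega
      by_cases c2 : l 2
      · refine hloc (fun i b => if b then x i else x' i) (fun i _ => v i) ?_ ?_ ?_ ?_
        · intro i hi b
          exact (hb i hi).2.1
        · intro i hi b
          obtain ⟨-, -, a1, a2, a3, -⟩ := hb i hi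
          have := hgt i hi
          try dsimp only
          split_ifs <;> omega
        · intro i j b b' hij hj
          have := (hl2 i j hij hj).2 c2
          have := hxx j (by omega)
          try dsimp only
          split_ifs <;> omega
        · intro i hi
          have := (hb i hi).2.2.2.2.2
          simpa using this
      · apply hfar
        left
        have hn : ∀ i j, i < j → j < T → x j ≤ v i := fun i j hij hj =>
          not_lt.1 (fun e => c2 ((hl2 i j hij hj).1 e))
        intro i j hi hj
        have a1 := hn (j + 1) (m + 4) (by omega) (by omega)
        have a2 := hsep (i + 1) (m + 4) (by omega) (by omega)
        omega

/-- **Corollary (block partition).**  If `|P_n| < F_{n,ℓ+1}` for some `ℓ, n`, then there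
is a `K` such that every graph in `P` can be partitioned into at most `K` blocks of
consecutive vertices, each `ℓ`-homogeneous. -/
theorem block_partition_of_small_speed (P : HerProp) (ℓ n : ℕ) (hℓ : 1 ≤ ℓ) (hn : 1 ≤ n)
    (h : speed P n < genFib (ℓ + 1) n) :
    ∃ K : ℕ, ∀ (N : ℕ) (G : SimpleGraph (Fin N)), G ∈ P.mem N →
      ∃ (m : ℕ) (c : Fin N → Fin m), m ≤ K ∧ Monotone c ∧ Function.Surjective c ∧
        ∀ x y : Fin N, c x = c y → lHom G ℓ x y := by
  classical
  obtain ⟨m, rfl⟩ : ∃ m, n = m + 1 := ⟨n - 1, by omega⟩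
  obtain ⟨K, hK⟩ := many_bad ℓ m hℓ
  refine ⟨2 * K + 1, fun N G hG => ?_⟩
  rcases blocks G ℓ K 0 with ⟨c, hc1, hc2, hc3⟩ | ⟨x, x', v, h1, h2⟩
  · let S : Finset ℕ := Finset.univ.image (fun x : Fin N => c x)
    have hmem : ∀ x : Fin N, c x ∈ S := fun x => Finset.mem_image_of_mem _ (Finset.mem_univ x)
    let e := S.orderIsoOfFin rfl
    refine ⟨S.card, fun x => e.symm ⟨c x, hmem x⟩, ?_, ?_, ?_, ?_⟩
    · have hsub : S ⊆ Finset.range (2 * K + 1) := by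
        intro a ha
        obtain ⟨x, -, rfl⟩ := Finset.mem_image.1 ha
        exact Finset.mem_range.2 (hc2 _)
      simpa using Finset.card_le_card hsub
    · intro a b hab
      apply e.symm.monotone
      exact hc1 (Fin.le_def.1 hab)
    · intro i
      obtain ⟨x, -, hx⟩ := Finset.mem_image.1 (e i).2
      refine ⟨x, ?_⟩
      rw [OrderIso.symm_apply_eq]
      exact Subtype.ext hx
    · intro a b hab
      have := e.symm.injective hab
      exact hc3 a b (Nat.zero_le _) (Nat.zero_le _) (congrArg Subtype.val this)
  · exact absurd (hK P N G hG x x' v (fun i hi => (h1 i hi).1) h2) (not_le.2 h)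
end
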